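/- Let Δ be a matroid complex on {1,…,r} that is not a cone. Then for all n ≥ 1, reg(I_Δ^{(n)}) = δ(I_Δ)·(n − 1) + b, where b = max{reg(I_Γ) : Γ is a subcomplex of Δ with F(Γ) ⊆ F(Δ)}; moreover b = dim(R/I_Δ) + 1 and δ(I_Δ) = d(I_Δ). -/

import Mathlib

open MvPolynomial Finset Filter

noncomputable section

/-- A family of potential faces (subsets of the vertex set `ι`). -/
abbrev FaceSet (ι : Type*) := Set (Finset ι)

/-- A face set is a simplicial complex if it is closed under taking subsets. -/
def IsSimplicialComplex {ι : Type*} (Δ : FaceSet ι) : Prop :=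
  ∀ σ ∈ Δ, ∀ τ : Finset ι, τ ⊆ σ → τ ∈ Δ

/-- The facets (maximal faces) of a face set. -/
def facets {ι : Type*} (Δ : FaceSet ι) : FaceSet ι :=
  {σ | σ ∈ Δ ∧ ∀ τ ∈ Δ, σ ⊆ τ → σ = τ}

/-- The Stanley–Reisner ideal of a simplicial complex: it is generated by the
square-free monomials corresponding to non-faces. -/
def srIdeal (K : Type*) [Field K] {ι : Type*} (Δ : FaceSet ι) :
    Ideal (MvPolynomial ι K) :=
  Ideal.span {p | ∃ τ : Finset ι, τ ∉ Δ ∧ p = ∏ i ∈ τ, X i}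

/-- The `n`-th symbolic power `I^{(n)} = ⋂_{p ∈ Min(I)} (Iⁿ R_p ∩ R)`. -/
def symbolicPower {R : Type*} [CommRing R] (I : Ideal R) (n : ℕ) : Ideal R :=
  ⨅ (p : Ideal R) (hp : p ∈ I.minimalPrimes),
    letI : p.IsPrime := hp.1.1
    (Ideal.map (algebraMap R (Localization.AtPrime p)) (I ^ n)).comap
      (algebraMap R (Localization.AtPrime p))

/-- The simplicial boundary operator on the space of chains (finitely supported
`K`-valued functions on finite subsets of `ι`), using the orientation coming
from the linear order of `ι`; a set of cardinality `d` is viewed as a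
`(d-1)`-dimensional simplex, the empty set accounting for the augmentation. -/
def bdry (K : Type*) [Field K] {ι : Type*} [LinearOrder ι] :
    (Finset ι →₀ K) →ₗ[K] (Finset ι →₀ K) :=
  Finsupp.lsum K fun σ => LinearMap.toSpanSingleton K _
    (∑ v ∈ σ, ((-1 : K) ^ (σ.filter fun w => w < v).card) • Finsupp.single (σ.erase v) (1 : K))

/-- The subspace of chains supported on the faces of `Δ` of cardinality `d`. -/
def cardFaces (K : Type*) [Field K] {ι : Type*} (Δ : FaceSet ι) (d : ℕ) :
    Submodule K (Finset ι →₀ K) :=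
  Submodule.span K {f | ∃ σ ∈ Δ, σ.card = d ∧ f = Finsupp.single σ (1 : K)}

/-- `H̃ⱼ(Δ; K) ≠ 0`: there is a cycle of cardinality-degree `j + 1` which is not
a boundary of a chain of `Δ`. -/
def HasNontrivialReducedHomology (K : Type*) [Field K] {ι : Type*} [LinearOrder ι]
    (Δ : FaceSet ι) (j : ℤ) : Prop :=
  ∃ d : ℕ, (d : ℤ) = j + 1 ∧
    ∃ z ∈ cardFaces K Δ d, bdry K z = 0 ∧ z ∉ ⇑(bdry K) '' ↑(cardFaces K Δ (d + 1))

/-- `G_α = {i : α_i < 0}`. -/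
def negSupport {ι : Type*} [Fintype ι] (α : ι → ℤ) : Finset ι :=
  Finset.univ.filter fun i => α i < 0

/-- The degree complex `Δ_α(I) = {F ⊆ [r] \ G_α : x^α ∉ I·R_F}` of Takayama, where
`x^α ∈ I·R_F` is expressed by saturation: `x^{α⁺}·(∏_{i ∈ F ∪ G_α} x_i)^m ∈ I` for some `m`. -/
def degreeComplex (K : Type*) [Field K] {ι : Type*} [Fintype ι] [LinearOrder ι]
    (I : Ideal (MvPolynomial ι K)) (α : ι → ℤ) : FaceSet ι :=
  {F | (∀ i ∈ F, 0 ≤ α i) ∧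
    ¬∃ m : ℕ,
      monomial (Finsupp.equivFunOnFinite.symm fun i => (α i).toNat) (1 : K) *
        (∏ i ∈ F ∪ negSupport α, X i) ^ m ∈ I}

/-- Nonvanishing of the graded piece `H_𝔪^i(R/I)_α` of local cohomology of a monomial
quotient, expressed via Takayama's formula
`dim_K H_𝔪^i(R/I)_α = dim_K H̃_{i-|G_α|-1}(Δ_α(I); K)`. -/
def lcNonzero (K : Type*) [Field K] {ι : Type*} [Fintype ι] [LinearOrder ι]
    (I : Ideal (MvPolynomial ι K)) (i : ℕ) (α : ι → ℤ) : Prop :=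
  HasNontrivialReducedHomology K (degreeComplex K I α) ((i : ℤ) - (negSupport α).card - 1)

/-- The `a_i`-invariant `a_i(R/I) = max{t : H_𝔪^i(R/I)_t ≠ 0}` of a monomial quotient
(`H_𝔪^i(R/I)_t = ⊕_{|α| = t} H_𝔪^i(R/I)_α`). -/
def aInv (K : Type*) [Field K] {ι : Type*} [Fintype ι] [LinearOrder ι]
    (I : Ideal (MvPolynomial ι K)) (i : ℕ) : ℤ :=
  sSup {z : ℤ | ∃ α : ι → ℤ, lcNonzero K I i α ∧ z = ∑ j, α j}

/-- The Castelnuovo–Mumford regularity `reg(R/I) = max_i (a_i(R/I) + i)` of a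
monomial quotient. -/
def regQuot (K : Type*) [Field K] {ι : Type*} [Fintype ι] [LinearOrder ι]
    (I : Ideal (MvPolynomial ι K)) : ℤ :=
  sSup {z : ℤ | ∃ (i : ℕ) (α : ι → ℤ), lcNonzero K I i α ∧ z = (∑ j, α j) + i}

/-- The Castelnuovo–Mumford regularity of a (monomial) ideal: `reg(I) = reg(R/I) + 1`. -/
def reg (K : Type*) [Field K] {ι : Type*} [Fintype ι] [LinearOrder ι]
    (I : Ideal (MvPolynomial ι K)) : ℤ :=
  regQuot K I + 1

/-- The depth `min{i : H_𝔪^i(R/I) ≠ 0}` of a monomial quotient. -/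
def depthQuot (K : Type*) [Field K] {ι : Type*} [Fintype ι] [LinearOrder ι]
    (I : Ideal (MvPolynomial ι K)) : ℕ :=
  sInf {i : ℕ | ∃ α : ι → ℤ, lcNonzero K I i α}

/-- The projective dimension `pd(R/I) = r - depth(R/I)` (Auslander–Buchsbaum). -/
def pdQuot (K : Type*) [Field K] {ι : Type*} [Fintype ι] [LinearOrder ι]
    (I : Ideal (MvPolynomial ι K)) : ℤ :=
  (Fintype.card ι : ℤ) - depthQuot K I

end
/-- The degrees of the minimal monomial generators of a monomial ideal `I`;
`d(I)` is the greatest element. -/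
def minGenDegrees (K : Type*) [Field K] {ι : Type*} [Fintype ι]
    (I : Ideal (MvPolynomial ι K)) : Set ℕ :=
  {d | ∃ a : ι →₀ ℕ, monomial a (1 : K) ∈ I ∧
    (∀ b : ι →₀ ℕ, b ≤ a → b ≠ a → monomial b (1 : K) ∉ I) ∧
    d = a.sum fun _ k => k}
/-- The restriction `Δ[σ] = {τ ∈ Δ : τ ⊆ σ}`. -/
def restrictionFaceSet {ι : Type*} (Δ : FaceSet ι) (σ : Finset ι) : FaceSet ι :=
  {τ | τ ∈ Δ ∧ τ ⊆ σ}

/-- A face set is pure if all its facets have the same cardinality. -/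
def IsPureFaceSet {ι : Type*} (Δ : FaceSet ι) : Prop :=
  ∀ τ₁ ∈ facets Δ, ∀ τ₂ ∈ facets Δ, τ₁.card = τ₂.card

/-- A matroid complex: a simplicial complex all of whose restrictions are pure. -/
def IsMatroidComplex {ι : Type*} (Δ : FaceSet ι) : Prop :=
  IsSimplicialComplex Δ ∧ ∀ σ : Finset ι, IsPureFaceSet (restrictionFaceSet Δ σ)

/-- `Δ` is a cone over the vertex `v`: `{v} ∪ F ∈ Δ` for every `F ∈ Δ`. -/
def IsConeOver {ι : Type*} [DecidableEq ι] (Δ : FaceSet ι) (v : ι) : Prop :=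
  ∀ F ∈ Δ, insert v F ∈ Δ

section Homology

variable (K : Type*) [Field K] {ι : Type*} [LinearOrder ι]

/-- Every cycle of `Δ` supported in cardinality `d` is a boundary. -/
def AcyclicAt (Δ : FaceSet ι) (d : ℕ) : Prop :=
  ∀ z ∈ cardFaces K Δ d, bdry K z = 0 → ∃ y ∈ cardFaces K Δ (d + 1), bdry K y = z

/-- The number of elements of `F` below `v`; its parity is the incidence sign. -/
def posIn (F : Finset ι) (v : ι) : ℕ := (F.filter fun w => w < v).card

/-- The operation of coning with apex `v` on chains. -/
noncomputable def coneMap (v : ι) : (Finset ι →₀ K) →ₗ[K] (Finset ι →₀ K) :=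
  Finsupp.lsum K fun σ => LinearMap.toSpanSingleton K _
    (if v ∈ σ then 0 else ((-1 : K) ^ posIn σ v) • Finsupp.single (insert v σ) (1 : K))

variable {K}

omit [LinearOrder ι] in
lemma cardFaces_eq_supported (Δ : FaceSet ι) (d : ℕ) :
    cardFaces K Δ d = Finsupp.supported K K {σ | σ ∈ Δ ∧ σ.card = d} := by
  rw [Finsupp.supported_eq_span_single, cardFaces]
  congr 1
  ext f
  simp only [Set.mem_ofPred_eq, Set.mem_image]
  constructor
  · rintro ⟨σ, h1, h2, rfl⟩
    exact ⟨σ, ⟨h1, h2⟩, rfl⟩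
  · rintro ⟨σ, ⟨h1, h2⟩, rfl⟩
    exact ⟨σ, h1, h2, rfl⟩

omit [LinearOrder ι] in
lemma mem_cardFaces {Δ : FaceSet ι} {d : ℕ} {z : Finset ι →₀ K} :
    z ∈ cardFaces K Δ d ↔ ∀ σ, z σ ≠ 0 → σ ∈ Δ ∧ σ.card = d := by
  rw [cardFaces_eq_supported, Finsupp.mem_supported']
  constructor
  · intro h σ hσ
    by_contra hn
    exact hσ (h σ hn)
  · intro h σ hσ
    by_contra hn
    exact hσ (h σ hn)

lemma bdry_single (σ : Finset ι) :
    bdry K (Finsupp.single σ (1 : K)) =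
      ∑ v ∈ σ, ((-1 : K) ^ posIn σ v) • Finsupp.single (σ.erase v) (1 : K) := by
  simp [bdry, posIn]

lemma coneMap_single_of_mem {v : ι} {σ : Finset ι} (h : v ∈ σ) :
    coneMap K v (Finsupp.single σ (1 : K)) = 0 := by
  simp [coneMap, h]

lemma coneMap_single_of_notMem {v : ι} {σ : Finset ι} (h : v ∉ σ) :
    coneMap K v (Finsupp.single σ (1 : K)) =
      ((-1 : K) ^ posIn σ v) • Finsupp.single (insert v σ) (1 : K) := by
  simp [coneMap, h]

omit [LinearOrder ι] in
/-- A linear map on chains sends chains supported on `S` into any submodule containing the images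
of the faces in `S`. -/
lemma map_mem_of_supported (f : (Finset ι →₀ K) →ₗ[K] (Finset ι →₀ K)) (S : Set (Finset ι))
    (N : Submodule K (Finset ι →₀ K)) (h : ∀ σ ∈ S, f (Finsupp.single σ 1) ∈ N)
    {z : Finset ι →₀ K} (hz : z ∈ Finsupp.supported K K S) : f z ∈ N := by
  rw [Finsupp.supported_eq_span_single] at hz
  have : Submodule.span K ((fun i => Finsupp.single i (1 : K)) '' S) ≤ N.comap f := by
    rw [Submodule.span_le]
    rintro _ ⟨σ, hσ, rfl⟩
    exact h σ hσ
  exact this hz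

lemma bdry_mem_supported {S T : Set (Finset ι)} {z : Finset ι →₀ K}
    (hz : z ∈ Finsupp.supported K K S) (h : ∀ σ ∈ S, ∀ v ∈ σ, σ.erase v ∈ T) :
    bdry K z ∈ Finsupp.supported K K T := by
  refine map_mem_of_supported _ S _ (fun σ hσ => ?_) hz
  rw [bdry_single]
  exact Submodule.sum_mem _ fun v hv =>
    Submodule.smul_mem _ _ (Finsupp.single_mem_supported K _ (h σ hσ v hv))

lemma coneMap_mem_supported {v : ι} {S T : Set (Finset ι)} {z : Finset ι →₀ K}
    (hz : z ∈ Finsupp.supported K K S) (h : ∀ σ ∈ S, v ∉ σ → insert v σ ∈ T) :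
    coneMap K v z ∈ Finsupp.supported K K T := by
  refine map_mem_of_supported _ S _ (fun σ hσ => ?_) hz
  by_cases hv : v ∈ σ
  · rw [coneMap_single_of_mem hv]; exact Submodule.zero_mem _
  · rw [coneMap_single_of_notMem hv]
    exact Submodule.smul_mem _ _ (Finsupp.single_mem_supported K _ (h σ hσ hv))

lemma posIn_insert_of_lt {σ : Finset ι} {v x : ι} (hv : v ∉ σ) (h : v < x) :
    posIn (insert v σ) x = posIn σ x + 1 := by
  rw [posIn, posIn, Finset.filter_insert, if_pos h, Finset.card_insert_of_notMem]
  simp [hv]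

lemma posIn_insert_of_le {σ : Finset ι} {v x : ι} (h : x ≤ v) :
    posIn (insert v σ) x = posIn σ x := by
  rw [posIn, posIn, Finset.filter_insert, if_neg (not_lt.2 h)]

lemma posIn_erase_of_lt {σ : Finset ι} {v x : ι} (hv : v ∈ σ) (h : v < x) :
    posIn σ x = posIn (σ.erase v) x + 1 := by
  conv_lhs => rw [← Finset.insert_erase hv]
  exact posIn_insert_of_lt (Finset.notMem_erase v σ) h

lemma posIn_erase_of_le {σ : Finset ι} {v x : ι} (hv : v ∈ σ) (h : x ≤ v) :
    posIn σ x = posIn (σ.erase v) x := by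
  conv_lhs => rw [← Finset.insert_erase hv]
  exact posIn_insert_of_le h

lemma neg_one_pow_mul_self (n : ℕ) : (-1 : K) ^ n * (-1 : K) ^ n = 1 := by
  rw [← mul_pow]; simp

lemma bdry_coneMap_single (v : ι) (σ : Finset ι) :
    bdry K (coneMap K v (Finsupp.single σ (1 : K))) + coneMap K v (bdry K (Finsupp.single σ 1)) =
      Finsupp.single σ 1 := by
  by_cases hv : v ∈ σ
  · rw [coneMap_single_of_mem hv, map_zero, zero_add, bdry_single, map_sum,
      Finset.sum_eq_single_of_mem v hv]
    · rw [map_smul, coneMap_single_of_notMem (Finset.notMem_erase v σ), Finset.insert_erase hv,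
        smul_smul, ← posIn_erase_of_le hv le_rfl, neg_one_pow_mul_self, one_smul]
    · intro x _ hx
      rw [map_smul, coneMap_single_of_mem (Finset.mem_erase.2 ⟨hx.symm, hv⟩), smul_zero]
  · rw [coneMap_single_of_notMem hv, map_smul, bdry_single, bdry_single,
      Finset.sum_insert hv, Finset.erase_insert hv, posIn_insert_of_le le_rfl, smul_add,
      smul_smul, neg_one_pow_mul_self, one_smul, add_assoc, map_sum, Finset.smul_sum,
      ← Finset.sum_add_distrib, Finset.sum_eq_zero, add_zero]
    intro x hx
    have hxv : x ≠ v := fun h => hv (h ▸ hx)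
    have hv' : v ∉ σ.erase x := fun h => hv (Finset.mem_of_mem_erase h)
    rw [map_smul, coneMap_single_of_notMem hv', Finset.erase_insert_of_ne hxv.symm, smul_smul,
      smul_smul, ← add_smul]
    rcases lt_or_gt_of_ne hxv with h | h
    · rw [posIn_insert_of_le h.le, posIn_erase_of_lt hx h]
      ring_nf
      simp
    · rw [posIn_insert_of_lt hv h, posIn_erase_of_le hx h.le]
      ring_nf
      simp

lemma bdry_coneMap (v : ι) (z : Finset ι →₀ K) :
    bdry K (coneMap K v z) + coneMap K v (bdry K z) = z := by
  have : bdry K ∘ₗ coneMap K v + coneMap K v ∘ₗ bdry K = LinearMap.id := by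
    refine Finsupp.lhom_ext' fun σ => LinearMap.ext_ring ?_
    simpa using bdry_coneMap_single v σ
  exact LinearMap.congr_fun this z

lemma bdry_bdry_single (σ : Finset ι) : bdry K (bdry K (Finsupp.single σ (1 : K))) = 0 := by
  induction σ using Finset.induction_on with
  | empty => simp [bdry_single]
  | insert v σ hv ih =>
    have h1 := bdry_coneMap v (Finsupp.single σ (1 : K))
    have h2 := bdry_coneMap v (bdry K (Finsupp.single σ (1 : K)))
    rw [ih, map_zero, add_zero] at h2
    have h3 := congrArg (bdry K) h1
    rw [map_add, h2, add_eq_right, coneMap_single_of_notMem hv, map_smul, map_smul] at h3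
    exact (smul_eq_zero.1 h3).resolve_left (pow_ne_zero _ (by simp))

lemma bdry_bdry (z : Finset ι →₀ K) : bdry K (bdry K z) = 0 := by
  have : bdry K ∘ₗ bdry K = (0 : (Finset ι →₀ K) →ₗ[K] (Finset ι →₀ K)) := by
    refine Finsupp.lhom_ext' fun σ => LinearMap.ext_ring ?_
    simpa using bdry_bdry_single σ
  exact LinearMap.congr_fun this z

lemma hasNontrivialReducedHomology_iff {Δ : FaceSet ι} {j : ℤ} :
    HasNontrivialReducedHomology K Δ j ↔ ∃ d : ℕ, (d : ℤ) = j + 1 ∧ ¬ AcyclicAt K Δ d := by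
  unfold HasNontrivialReducedHomology AcyclicAt
  simp only [Set.mem_image, SetLike.mem_coe]
  push Not
  rfl

/-- A cone is acyclic. -/
lemma acyclicAt_of_cone {Δ : FaceSet ι} {v : ι} (h : ∀ F ∈ Δ, insert v F ∈ Δ) (d : ℕ) :
    AcyclicAt K Δ d := by
  intro z hz hz0
  refine ⟨coneMap K v z, ?_, ?_⟩
  · rw [cardFaces_eq_supported] at hz ⊢
    refine coneMap_mem_supported hz fun σ hσ hv => ⟨h σ hσ.1, ?_⟩
    rw [Finset.card_insert_of_notMem hv, hσ.2]
  · simpa [hz0] using bdry_coneMap v z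

lemma exists_face_of_not_acyclicAt {Δ : FaceSet ι} {d : ℕ} (h : ¬ AcyclicAt K Δ d) :
    ∃ σ ∈ Δ, σ.card = d := by
  by_contra hn
  refine h fun z hz _ => ⟨0, Submodule.zero_mem _, ?_⟩
  rw [map_zero]
  ext σ
  by_contra hσ
  exact hn ⟨σ, mem_cardFaces.1 hz σ (Ne.symm hσ)⟩

/-- Attaching a simplex `B` along a cone with apex in `B` preserves acyclicity. -/
lemma AcyclicAt.union_simplex_of_cone {Γ : FaceSet ι} (hΓ : IsSimplicialComplex Γ)
    {B : Finset ι} {v : ι} (hv : v ∈ B) (hcone : ∀ F ∈ Γ, F ⊆ B → insert v F ∈ Γ) {d : ℕ}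
    (h : AcyclicAt K Γ d) : AcyclicAt K (Γ ∪ {F | F ⊆ B}) d := by
  classical
  intro z hz hz0
  rw [cardFaces_eq_supported] at hz
  have hz' := Finsupp.mem_supported' K z |>.1 hz
  set a := z.filter (fun σ => σ ∉ Γ) with ha
  set o := z.filter (fun σ => ¬ σ ∉ Γ) with ho
  have hao : a + o = z := Finsupp.filter_add_filter_not z _
  have hasup : a ∈ Finsupp.supported K K {σ | σ ⊆ B ∧ σ.card = d} := by
    rw [Finsupp.mem_supported']
    intro σ hσ
    by_cases hs : σ ∉ Γ
    · rw [ha, Finsupp.filter_apply, if_pos hs]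
      refine hz' σ fun hm => hσ ⟨?_, hm.2⟩
      exact hm.1.resolve_left hs
    · rw [ha, Finsupp.filter_apply, if_neg hs]
  have hosup : o ∈ Finsupp.supported K K {σ | σ ∈ Γ ∧ σ.card = d} := by
    rw [Finsupp.mem_supported']
    intro σ hσ
    by_cases hs : σ ∈ Γ
    · rw [ho, Finsupp.filter_apply, if_pos (not_not.2 hs)]
      exact hz' σ fun hm => hσ ⟨hs, hm.2⟩
    · rw [ho, Finsupp.filter_apply, if_neg (not_not.2 hs)]
  have hda1 : bdry K a ∈ Finsupp.supported K K {σ | σ ⊆ B ∧ σ.card + 1 = d} :=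
    bdry_mem_supported hasup fun σ hσ x hx => ⟨(Finset.erase_subset _ _).trans hσ.1, by
      rw [Finset.card_erase_add_one hx, hσ.2]⟩
  have hda2 : bdry K a ∈ Finsupp.supported K K {σ | σ ∈ Γ} := by
    have : bdry K a = - bdry K o := by
      rw [eq_neg_iff_add_eq_zero, ← map_add, hao, hz0]
    rw [this]
    exact Submodule.neg_mem _ (bdry_mem_supported hosup
      fun σ hσ x hx => hΓ σ hσ.1 _ (Finset.erase_subset _ _))
  have hda : bdry K a ∈ Finsupp.supported K K {σ | σ ∈ Γ ∧ σ ⊆ B ∧ σ.card + 1 = d} := by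
    rw [Finsupp.mem_supported'] at hda1 hda2 ⊢
    intro σ hσ
    by_cases hs : σ ∈ Γ
    · exact hda1 σ fun hm => hσ ⟨hs, hm⟩
    · exact hda2 σ hs
  have hcda : coneMap K v (bdry K a) ∈ Finsupp.supported K K {σ | σ ∈ Γ ∧ σ.card = d} :=
    coneMap_mem_supported hda fun σ hσ hvs => ⟨hcone σ hσ.1 hσ.2.1, by
      rw [Finset.card_insert_of_notMem hvs, hσ.2.2]⟩
  have hca : coneMap K v a ∈ cardFaces K (Γ ∪ {F | F ⊆ B}) (d + 1) := by
    rw [cardFaces_eq_supported]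
    exact coneMap_mem_supported hasup fun σ hσ hvs =>
      ⟨Or.inr (Finset.insert_subset hv hσ.1), by rw [Finset.card_insert_of_notMem hvs, hσ.2]⟩
  have hid := bdry_coneMap v a
  obtain ⟨y, hy, hyz⟩ := h (o + coneMap K v (bdry K a))
    (by rw [cardFaces_eq_supported]; exact Submodule.add_mem _ hosup hcda) (by
      have : o + coneMap K v (bdry K a) = z - bdry K (coneMap K v a) := by
        rw [eq_sub_iff_add_eq, add_assoc, add_comm (coneMap K v _), hid, add_comm, hao]
      rw [this, map_sub, hz0, bdry_bdry, sub_zero])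
  refine ⟨y + coneMap K v a, Submodule.add_mem _ ?_ hca, ?_⟩
  · rw [mem_cardFaces] at hy ⊢
    exact fun σ hσ => ⟨Or.inl (hy σ hσ).1, (hy σ hσ).2⟩
  · rw [map_add, hyz, add_assoc, add_comm (coneMap K v _), hid, add_comm, hao]

/-- Attaching a simplex `B` along its whole boundary changes homology only in cardinality degree
at least `B.card`. -/
lemma AcyclicAt.union_simplex_of_bdry {Γ : FaceSet ι} {B : Finset ι}
    (hB : ∀ F, F ⊂ B → F ∈ Γ) {d : ℕ} (hd : d ≠ B.card)
    (h : AcyclicAt K Γ d) : AcyclicAt K (Γ ∪ {F | F ⊆ B}) d := by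
  intro z hz hz0
  obtain ⟨y, hy, hyz⟩ := h z (by
    rw [mem_cardFaces] at hz ⊢
    intro σ hσ
    obtain ⟨h1, h2⟩ := hz σ hσ
    refine ⟨h1.elim id fun h3 => hB σ ?_, h2⟩
    refine (Finset.ssubset_iff_subset_ne).2 ⟨h3, ?_⟩
    rintro rfl
    exact hd h2.symm) hz0
  refine ⟨y, ?_, hyz⟩
  rw [mem_cardFaces] at hy ⊢
  exact fun σ hσ => ⟨Or.inl (hy σ hσ).1, (hy σ hσ).2⟩

end Homology

section Matroid

variable {ι : Type*} [DecidableEq ι]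

/-- The faces of the complex generated by a finite family of sets. -/
def generated (𝓑 : Finset (Finset ι)) : FaceSet ι := {F | ∃ B ∈ 𝓑, F ⊆ B}

omit [DecidableEq ι] in
lemma isSimplicialComplex_generated (𝓑 : Finset (Finset ι)) :
    IsSimplicialComplex (generated 𝓑) :=
  fun _ ⟨B, hB, hσ⟩ _ hτ => ⟨B, hB, hτ.trans hσ⟩

omit [DecidableEq ι] in
/-- Any face inside a finite set `S` extends to a face that is maximal inside `S`. -/
lemma exists_facet_restriction {Δ : FaceSet ι} {F S : Finset ι} (hF : F ∈ Δ) (hFS : F ⊆ S) :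
    ∃ T ∈ facets (restrictionFaceSet Δ S), F ⊆ T := by
  classical
  obtain ⟨T, hT, hmax⟩ := Finset.exists_max_image (S.powerset.filter fun T => T ∈ Δ ∧ F ⊆ T)
    Finset.card ⟨F, by simp [hF, hFS]⟩
  simp only [Finset.mem_filter, Finset.mem_powerset] at hT hmax
  refine ⟨T, ⟨⟨hT.2.1, hT.1⟩, fun U hU hTU => ?_⟩, hT.2.2⟩
  exact Finset.eq_of_subset_of_card_le hTU (hmax U ⟨hU.2, hU.1, hT.2.2.trans hTU⟩)

omit [DecidableEq ι] in
lemma facets_restriction_univ [Fintype ι] (Δ : FaceSet ι) :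
    facets (restrictionFaceSet Δ Finset.univ) = facets Δ := by
  have : restrictionFaceSet Δ Finset.univ = Δ := by ext; simp [restrictionFaceSet]
  rw [this]

omit [DecidableEq ι] in
lemma exists_facet [Fintype ι] {Δ : FaceSet ι} {F : Finset ι} (hF : F ∈ Δ) :
    ∃ T ∈ facets Δ, F ⊆ T := by
  obtain ⟨T, hT, h⟩ := exists_facet_restriction hF (Finset.subset_univ F)
  exact ⟨T, by rwa [facets_restriction_univ] at hT, h⟩

omit [DecidableEq ι] in
lemma IsMatroidComplex.card_eq [Fintype ι] {Δ : FaceSet ι} (h : IsMatroidComplex Δ)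
    {B B' : Finset ι} (hB : B ∈ facets Δ) (hB' : B' ∈ facets Δ) : B.card = B'.card :=
  h.2 Finset.univ B (by rwa [facets_restriction_univ]) B' (by rwa [facets_restriction_univ])

omit [DecidableEq ι] in
lemma IsMatroidComplex.mem_facets_of_card [Fintype ι] {Δ : FaceSet ι} (h : IsMatroidComplex Δ)
    {B B' : Finset ι} (hB : B ∈ facets Δ) (hB' : B' ∈ Δ) (hc : B.card ≤ B'.card) :
    B' ∈ facets Δ := by
  obtain ⟨T, hT, hsub⟩ := exists_facet hB'
  rwa [Finset.eq_of_subset_of_card_le hsub (by rw [h.card_eq hT hB]; exact hc)]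

omit [DecidableEq ι] in
/-- A maximal face inside `S` has at least the cardinality of any other face inside `S`. -/
lemma IsMatroidComplex.card_le_of_restriction {Δ : FaceSet ι} (h : IsMatroidComplex Δ)
    {S F T : Finset ι} (hF : F ∈ Δ) (hFS : F ⊆ S) (hT : T ∈ facets (restrictionFaceSet Δ S)) :
    F.card ≤ T.card := by
  obtain ⟨U, hU, hFU⟩ := exists_facet_restriction hF hFS
  exact (Finset.card_le_card hFU).trans (h.2 S U hU T hT).le

/-- An inclusion-minimal nonface. -/
def IsMinNonface (Δ : FaceSet ι) (C : Finset ι) : Prop :=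
  C ∉ Δ ∧ ∀ D, D ⊂ C → D ∈ Δ

omit [DecidableEq ι] in
lemma exists_isMinNonface {Δ : FaceSet ι} {S : Finset ι} (hS : S ∉ Δ) :
    ∃ C ⊆ S, IsMinNonface Δ C := by
  classical
  obtain ⟨C, hC, hmin⟩ := Finset.exists_min_image (S.powerset.filter fun T => T ∉ Δ)
    Finset.card ⟨S, by simp [hS]⟩
  simp only [Finset.mem_filter, Finset.mem_powerset] at hC hmin
  refine ⟨C, hC.1, hC.2, fun D hD => ?_⟩
  by_contra hn
  exact absurd (Finset.card_lt_card hD) (not_lt.2 (hmin D ⟨hD.subset.trans hC.1, hn⟩))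

lemma insert_notMem_of_facet {Δ : FaceSet ι} {B : Finset ι} (hB : B ∈ facets Δ) {u : ι}
    (hu : u ∉ B) : insert u B ∉ Δ := fun h => by
  have := hB.2 _ h (Finset.subset_insert u B)
  exact hu (this ▸ Finset.mem_insert_self u B)

lemma card_exchange {B : Finset ι} {u v : ι} (hv : v ∈ B) (hu : u ∉ B) :
    (insert u (B.erase v)).card = B.card := by
  rw [Finset.card_insert_of_notMem (fun h => hu (Finset.mem_of_mem_erase h)),
    Finset.card_erase_add_one hv]

/-- Exchanging along a minimal nonface contained in `insert u B` yields a facet. -/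
lemma IsMatroidComplex.exchange_mem_facets [Fintype ι] {Δ : FaceSet ι} (h : IsMatroidComplex Δ)
    {B C : Finset ι} (hB : B ∈ facets Δ) {u v : ι} (hu : u ∉ B) (hC : IsMinNonface Δ C)
    (hCB : C ⊆ insert u B) (hvB : v ∈ B) (hvC : v ∈ C) :
    insert u (B.erase v) ∈ facets Δ := by
  obtain ⟨T, hT, hCT⟩ := exists_facet_restriction (hC.2 _ (Finset.erase_ssubset hvC))
    ((Finset.erase_subset v C).trans hCB)
  have hcard := h.card_le_of_restriction hB.1 (Finset.subset_insert u B) hT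
  have hvT : v ∉ T := fun hv => hC.1 <| h.1 T hT.1.1 C <| by
    rw [← Finset.insert_erase hvC]; exact Finset.insert_subset hv hCT
  have hsub : T ⊆ insert u (B.erase v) := fun x hx => by
    have := hT.1.2 hx
    simp only [Finset.mem_insert, Finset.mem_erase] at this ⊢
    exact this.imp id fun hxB => ⟨fun hxv => hvT (hxv ▸ hx), hxB⟩
  have : T = insert u (B.erase v) :=
    Finset.eq_of_subset_of_card_le hsub (by rw [card_exchange hvB hu]; exact hcard)
  rw [← this]
  exact h.mem_facets_of_card hB hT.1.1 hcard

/-- The symmetric exchange property of a family of sets. -/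
def SymmExchange (𝓜 : Finset (Finset ι)) : Prop :=
  ∀ B ∈ 𝓜, ∀ B' ∈ 𝓜, ∀ y ∈ B' \ B, ∃ x ∈ B \ B',
    insert y (B.erase x) ∈ 𝓜 ∧ insert x (B'.erase y) ∈ 𝓜

lemma IsMatroidComplex.exists_symm_exchange [Fintype ι] {Δ : FaceSet ι} (h : IsMatroidComplex Δ)
    {B B' : Finset ι} (hB : B ∈ facets Δ) (hB' : B' ∈ facets Δ) {y : ι} (hy : y ∈ B' \ B) :
    ∃ x ∈ B \ B', insert y (B.erase x) ∈ facets Δ ∧ insert x (B'.erase y) ∈ facets Δ := by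
  obtain ⟨hyB', hyB⟩ := Finset.mem_sdiff.1 hy
  obtain ⟨C, hCB, hC⟩ := exists_isMinNonface (insert_notMem_of_facet hB hyB)
  have hyC : y ∈ C := by
    by_contra hyC
    exact hC.1 (h.1 B hB.1 C ((Finset.subset_insert_iff_of_notMem hyC).1 hCB))
  have key : ∃ x ∈ C, x ≠ y ∧ x ∉ B' ∧ insert x (B'.erase y) ∈ Δ := by
    by_contra! hno
    have hE : B'.erase y ∈ facets (restrictionFaceSet Δ (C.erase y ∪ B'.erase y)) := by
      refine ⟨⟨h.1 B' hB'.1 _ (Finset.erase_subset _ _), Finset.subset_union_right⟩, ?_⟩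
      intro T hT hsub
      refine hsub.antisymm fun x hx => ?_
      by_contra hxE
      have hxC : x ∈ C.erase y := (Finset.mem_union.1 (hT.2 hx)).resolve_right hxE
      obtain ⟨hxy, hxC⟩ := Finset.mem_erase.1 hxC
      exact hno x hxC hxy (fun hxB' => hxE (Finset.mem_erase.2 ⟨hxy, hxB'⟩))
        (h.1 T hT.1 _ (Finset.insert_subset hx hsub))
    obtain ⟨T, hT, hCT⟩ := exists_facet_restriction (hC.2 _ (Finset.erase_ssubset hyC))
      (Finset.subset_union_left (s₁ := C.erase y) (s₂ := B'.erase y))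
    obtain ⟨U, hU, hTU⟩ := exists_facet_restriction hT.1.1
      (hT.1.2.trans (Finset.subset_insert y _))
    have h1 := h.2 _ T hT _ hE
    have h2 : B'.card ≤ U.card := by
      refine h.card_le_of_restriction hB'.1 ?_ hU
      rw [← Finset.insert_erase hyB']
      simp only [Finset.erase_insert_eq_erase, Finset.erase_idem]
      exact Finset.insert_subset_insert _ Finset.subset_union_right
    have h3 := Finset.card_erase_add_one hyB'
    by_cases hyU : y ∈ U
    · refine hC.1 (h.1 U hU.1.1 C ?_)
      rw [← Finset.insert_erase hyC]
      exact Finset.insert_subset hyU (hCT.trans hTU)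
    · have hUS := (Finset.subset_insert_iff_of_notMem hyU).1 hU.1.2
      have := h.card_le_of_restriction hU.1.1 hUS hE
      omega
  obtain ⟨x, hxC, hxy, hxB', hx⟩ := key
  have hxB : x ∈ B := (Finset.mem_insert.1 (hCB hxC)).resolve_left hxy
  refine ⟨x, Finset.mem_sdiff.2 ⟨hxB, hxB'⟩, h.exchange_mem_facets hB hyB hC hCB hxB hxC, ?_⟩
  exact h.mem_facets_of_card hB' hx (card_exchange hyB' hxB').ge

/-- A set of non-maximal weight in an exchange family can be improved by one exchange. -/
lemma SymmExchange.exists_improvement {𝓜 : Finset (Finset ι)} (h : SymmExchange 𝓜) (w : ι → ℕ)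
    {B B' : Finset ι} (hB : B ∈ 𝓜) (hB' : B' ∈ 𝓜) (hw : ∑ i ∈ B, w i < ∑ i ∈ B', w i) :
    ∃ x ∈ B \ B', ∃ y ∈ B' \ B, insert y (B.erase x) ∈ 𝓜 ∧ w x < w y := by
  induction hk : (B' \ B).card generalizing B' with
  | zero =>
    have hsub : B' ⊆ B := Finset.sdiff_eq_empty_iff_subset.1 (Finset.card_eq_zero.1 hk)
    exact absurd (Finset.sum_le_sum_of_subset hsub) (not_le.2 hw)
  | succ k ih =>
    obtain ⟨y, hy⟩ : (B' \ B).Nonempty := Finset.card_pos.1 (by omega)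
    obtain ⟨x, hx, h1, h2⟩ := h B hB B' hB' y hy
    by_cases hxy : w x < w y
    · exact ⟨x, hx, y, hy, h1, hxy⟩
    obtain ⟨hxB, hxB'⟩ := Finset.mem_sdiff.1 hx
    obtain ⟨hyB', hyB⟩ := Finset.mem_sdiff.1 hy
    have hsum : ∑ i ∈ insert x (B'.erase y), w i + w y = ∑ i ∈ B', w i + w x := by
      rw [Finset.sum_insert (fun h => hxB' (Finset.mem_of_mem_erase h)), add_assoc,
        Finset.sum_erase_add _ _ hyB', add_comm]
    have hsd : insert x (B'.erase y) \ B = (B' \ B).erase y := by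
      ext z
      simp only [Finset.mem_sdiff, Finset.mem_insert, Finset.mem_erase]
      constructor
      · rintro ⟨rfl | h, hz⟩
        · exact absurd hxB hz
        · exact ⟨h.1, h.2, hz⟩
      · rintro ⟨h, h', hz⟩
        exact ⟨Or.inr ⟨h, h'⟩, hz⟩
    obtain ⟨x', hx', y', hy', h3, h4⟩ := ih h2 (by omega) (by
      rw [hsd, Finset.card_erase_of_mem hy, hk]; rfl)
    rw [hsd] at hy'
    refine ⟨x', ?_, y', Finset.mem_of_mem_erase hy', h3, h4⟩
    simp only [Finset.mem_sdiff, Finset.mem_insert, Finset.mem_erase, not_or, not_and] at hx' ⊢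
    refine ⟨hx'.1, fun hxmem => hx'.2.2 ?_ hxmem⟩
    rintro rfl
    exact hyB hx'.1

end Matroid

section Shelling

variable {K : Type*} [Field K] {ι : Type*} [LinearOrder ι]

/-- `v` can be exchanged in `B` for some element of larger weight. -/
def IsPassive (𝓜 : Finset (Finset ι)) (w : ι → ℕ) (B : Finset ι) (v : ι) : Prop :=
  ∃ u ∉ B, insert u (B.erase v) ∈ 𝓜 ∧ w v < w u

lemma generated_eq_union_of_erase {𝓑 : Finset (Finset ι)} {B : Finset ι} (hB : B ∈ 𝓑) :
    generated 𝓑 = generated (𝓑.erase B) ∪ {F | F ⊆ B} := by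
  ext F
  simp only [generated, Set.mem_union, Set.mem_ofPred_eq]
  constructor
  · rintro ⟨B', hB', hF⟩
    by_cases h : B' = B
    · exact Or.inr (h ▸ hF)
    · exact Or.inl ⟨B', Finset.mem_erase.2 ⟨h, hB'⟩, hF⟩
  · rintro (⟨B', hB', hF⟩ | hF)
    · exact ⟨B', Finset.mem_of_mem_erase hB', hF⟩
    · exact ⟨B, hB, hF⟩

lemma sum_exchange_lt {w : ι → ℕ} {B : Finset ι} {u v : ι} (hv : v ∈ B) (hu : u ∉ B)
    (h : w v < w u) : ∑ i ∈ B, w i < ∑ i ∈ insert u (B.erase v), w i := by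
  rw [Finset.sum_insert (fun h => hu (Finset.mem_of_mem_erase h)), ← Finset.sum_erase_add _ _ hv]
  omega

/-- The complex generated by the members of large weight of an exchange family has homology only
coming from members all of whose elements are passive. -/
lemma SymmExchange.acyclicAt_generated {𝓜 : Finset (Finset ι)} (h : SymmExchange 𝓜) {w : ι → ℕ}
    (hw : ∀ B B' : Finset ι, ∑ i ∈ B, w i = ∑ i ∈ B', w i → B = B') {d : ℕ}
    (𝓑 : Finset (Finset ι)) (hsub : 𝓑 ⊆ 𝓜)
    (hup : ∀ B ∈ 𝓑, ∀ B' ∈ 𝓜, ∑ i ∈ B, w i < ∑ i ∈ B', w i → B' ∈ 𝓑)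
    (hpass : ∀ B ∈ 𝓑, d = B.card → ∃ v ∈ B, ¬ IsPassive 𝓜 w B v) :
    AcyclicAt K (generated 𝓑) d := by
  induction hk : 𝓑.card generalizing 𝓑 with
  | zero =>
    rw [Finset.card_eq_zero] at hk
    subst hk
    by_contra hn
    obtain ⟨σ, ⟨B, hB, -⟩, -⟩ := exists_face_of_not_acyclicAt hn
    exact absurd hB (Finset.notMem_empty B)
  | succ k ih =>
    obtain ⟨B, hB, hmin⟩ := Finset.exists_min_image 𝓑 (fun B => ∑ i ∈ B, w i)
      (Finset.card_pos.1 (by omega))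
    have hlt : ∀ B' ∈ 𝓑.erase B, ∑ i ∈ B, w i < ∑ i ∈ B', w i := fun B' hB' =>
      lt_of_le_of_ne (hmin B' (Finset.mem_of_mem_erase hB'))
        fun he => (Finset.mem_erase.1 hB').1 (hw _ _ he.symm)
    have hmem : ∀ B' ∈ 𝓜, ∑ i ∈ B, w i < ∑ i ∈ B', w i → B' ∈ 𝓑.erase B := fun B' hB' hl =>
      Finset.mem_erase.2 ⟨by rintro rfl; exact lt_irrefl _ hl, hup B hB B' hB' hl⟩
    have hacyc : AcyclicAt K (generated (𝓑.erase B)) d :=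
      ih (𝓑.erase B) ((Finset.erase_subset _ _).trans hsub)
        (fun B₁ hB₁ B₂ hB₂ hl => hmem B₂ hB₂ ((hlt B₁ hB₁).trans hl))
        (fun B₁ hB₁ => hpass B₁ (Finset.mem_of_mem_erase hB₁))
        (by rw [Finset.card_erase_of_mem hB, hk]; rfl)
    rw [generated_eq_union_of_erase hB]
    by_cases hall : ∀ v ∈ B, IsPassive 𝓜 w B v
    · refine hacyc.union_simplex_of_bdry (fun F hF => ?_) fun hd => ?_
      · obtain ⟨v, hvB, hvF⟩ := Finset.exists_of_ssubset hF
        obtain ⟨u, hu, hm, hl⟩ := hall v hvB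
        refine ⟨_, hmem _ hm (sum_exchange_lt hvB hu hl), ?_⟩
        exact (Finset.subset_erase.2 ⟨hF.subset, hvF⟩).trans (Finset.subset_insert _ _)
      · obtain ⟨v, hv, hnp⟩ := hpass B hB hd
        exact hnp (hall v hv)
    · push Not at hall
      obtain ⟨v, hv, hnp⟩ := hall
      refine hacyc.union_simplex_of_cone (isSimplicialComplex_generated _) hv ?_
      rintro F ⟨B', hB', hFB'⟩ hFB
      obtain ⟨x, hx, y, hy, hm, hl⟩ := h.exists_improvement w (hsub hB)
        (hsub (Finset.mem_of_mem_erase hB')) (hlt B' hB')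
      obtain ⟨hxB, hxB'⟩ := Finset.mem_sdiff.1 hx
      have hyB := (Finset.mem_sdiff.1 hy).2
      have hvx : v ≠ x := by
        rintro rfl
        exact hnp ⟨y, hyB, hm, hl⟩
      refine ⟨_, hmem _ hm (sum_exchange_lt hxB hyB hl), ?_⟩
      refine Finset.insert_subset (Finset.mem_insert_of_mem (Finset.mem_erase.2 ⟨hvx, hv⟩)) ?_
      exact (Finset.subset_erase.2 ⟨hFB, fun hxF => hxB' (hFB' hxF)⟩).trans
        (Finset.subset_insert _ _)

/-- If every element of every member can be exchanged within the family, then the generated complex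
has nonzero top homology. -/
lemma SymmExchange.not_acyclicAt_generated {𝓜 : Finset (Finset ι)} (h : SymmExchange 𝓜)
    {w : ι → ℕ} (hw : ∀ B B' : Finset ι, ∑ i ∈ B, w i = ∑ i ∈ B', w i → B = B') {d : ℕ}
    (𝓑 : Finset (Finset ι)) (hsub : 𝓑 ⊆ 𝓜) (hne : 𝓑.Nonempty) (hcard : ∀ B ∈ 𝓑, B.card = d)
    (hup : ∀ B ∈ 𝓑, ∀ B' ∈ 𝓜, ∑ i ∈ B, w i < ∑ i ∈ B', w i → B' ∈ 𝓑)
    (hex : ∀ B ∈ 𝓑, ∀ v ∈ B, ∃ u ∉ B, insert u (B.erase v) ∈ 𝓑) :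
    ¬ AcyclicAt K (generated 𝓑) d := by
  obtain ⟨B, hB, hmin⟩ := Finset.exists_min_image 𝓑 (fun B => ∑ i ∈ B, w i) hne
  have hno : ∀ σ ∈ generated 𝓑, σ.card ≤ d := by
    rintro σ ⟨B', hB', hσ⟩
    exact (Finset.card_le_card hσ).trans (hcard B' hB').le
  suffices hs : ∃ z ∈ cardFaces K (generated 𝓑) d, bdry K z = 0 ∧ z B ≠ 0 by
    obtain ⟨z, hz, hz0, hzB⟩ := hs
    intro ha
    obtain ⟨y, hy, rfl⟩ := ha z hz hz0
    refine hzB ?_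
    have : y = 0 := by
      ext σ
      by_contra hσ
      obtain ⟨h1, h2⟩ := mem_cardFaces.1 hy σ hσ
      have := hno σ h1
      omega
    simp [this]
  have hSB : Finsupp.single B (1 : K) ∈ cardFaces K (generated 𝓑) d := by
    rw [cardFaces_eq_supported]
    exact Finsupp.single_mem_supported K _ ⟨⟨B, hB, Finset.Subset.refl B⟩, hcard B hB⟩
  rcases Nat.eq_zero_or_pos d with rfl | hd
  · refine ⟨Finsupp.single B 1, hSB, ?_, by simp⟩
    rw [bdry_single, Finset.card_eq_zero.1 (hcard B hB), Finset.sum_empty]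
  obtain ⟨e, rfl⟩ : ∃ e, d = e + 1 := ⟨d - 1, by omega⟩
  have hlt : ∀ B' ∈ 𝓑.erase B, ∑ i ∈ B, w i < ∑ i ∈ B', w i := fun B' hB' =>
    lt_of_le_of_ne (hmin B' (Finset.mem_of_mem_erase hB'))
      fun he => (Finset.mem_erase.1 hB').1 (hw _ _ he.symm)
  have hacyc : AcyclicAt K (generated (𝓑.erase B)) e := by
    refine h.acyclicAt_generated hw _ ((Finset.erase_subset _ _).trans hsub) ?_ ?_
    · intro B₁ hB₁ B₂ hB₂ hl
      refine Finset.mem_erase.2 ⟨?_, hup B₁ (Finset.mem_of_mem_erase hB₁) B₂ hB₂ hl⟩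
      rintro rfl
      exact absurd (hlt B₁ hB₁) (not_lt.2 hl.le)
    · intro B₁ hB₁ he
      have := hcard B₁ (Finset.mem_of_mem_erase hB₁)
      omega
  obtain ⟨y, hy, hyB⟩ := hacyc (bdry K (Finsupp.single B 1)) (by
    rw [cardFaces_eq_supported, bdry_single]
    refine Submodule.sum_mem _ fun v hv => Submodule.smul_mem _ _
      (Finsupp.single_mem_supported K _ ⟨?_, ?_⟩)
    · obtain ⟨u, hu, hm⟩ := hex B hB v hv
      refine ⟨_, Finset.mem_erase.2 ⟨?_, hm⟩, Finset.subset_insert _ _⟩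
      intro he
      exact hu (he ▸ Finset.mem_insert_self _ _)
    · rw [Finset.card_erase_of_mem hv, hcard B hB]; rfl) (bdry_bdry _)
  have hyB0 : y B = 0 := by
    by_contra hyB0
    obtain ⟨⟨B', hB', hsubB⟩, -⟩ := mem_cardFaces.1 hy B hyB0
    obtain ⟨hne, hB'⟩ := Finset.mem_erase.1 hB'
    exact hne (Finset.eq_of_subset_of_card_le hsubB (by rw [hcard B hB, hcard B' hB'])).symm
  refine ⟨Finsupp.single B 1 - y, Submodule.sub_mem _ hSB ?_, ?_, by simp [hyB0]⟩
  · rw [mem_cardFaces] at hy ⊢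
    intro σ hσ
    obtain ⟨⟨B', hB', h1⟩, h2⟩ := hy σ hσ
    exact ⟨⟨B', Finset.mem_of_mem_erase hB', h1⟩, h2⟩
  · rw [map_sub, hyB, sub_self]

omit [LinearOrder ι] in
/-- Any weight can be refined to one separating all finite sets. -/
lemma exists_generic_weight [Fintype ι] (w : ι → ℕ) : ∃ w' : ι → ℕ,
    (∀ B B' : Finset ι, ∑ i ∈ B, w' i < ∑ i ∈ B', w' i → ∑ i ∈ B, w i ≤ ∑ i ∈ B', w i) ∧
    (∀ B B' : Finset ι, ∑ i ∈ B, w' i = ∑ i ∈ B', w' i → B = B') := by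
  classical
  let e := Fintype.equivFin ι
  let N := 2 ^ Fintype.card ι
  have hsum : ∀ B : Finset ι, ∑ i ∈ B, 2 ^ (e i : ℕ) =
      ∑ j ∈ B.image fun i => (e i : ℕ), 2 ^ j := fun B => by
    rw [Finset.sum_image]
    exact fun x _ y _ h => e.injective (Fin.ext h)
  have hlt : ∀ B : Finset ι, ∑ i ∈ B, 2 ^ (e i : ℕ) < N := fun B => by
    rw [hsum]
    refine Nat.geomSum_lt le_rfl fun k hk => ?_
    obtain ⟨i, -, rfl⟩ := Finset.mem_image.1 hk
    exact (e i).2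
  have hw : ∀ B : Finset ι, ∑ i ∈ B, (w i * N + 2 ^ (e i : ℕ)) =
      (∑ i ∈ B, w i) * N + ∑ i ∈ B, 2 ^ (e i : ℕ) := fun B => by
    rw [Finset.sum_add_distrib, Finset.sum_mul]
  refine ⟨fun i => w i * N + 2 ^ (e i : ℕ), fun B B' h => ?_, fun B B' h => ?_⟩
  · rw [hw, hw] at h
    by_contra! hl
    have h1 := hlt B
    have h2 := Nat.mul_le_mul_right N (Nat.succ_le_of_lt hl)
    rw [Nat.succ_mul] at h2
    have h3 := hlt B'
    omega
  · rw [hw, hw] at h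
    have h1 := congrArg (· % N) h
    simp only [Nat.add_mod, Nat.mul_mod_left, zero_add,
      Nat.mod_eq_of_lt (hlt _)] at h1
    rw [hsum, hsum] at h1
    exact Finset.image_injective (fun x y h => e.injective (Fin.ext h))
      (Finset.geomSum_injective le_rfl h1)

end Shelling

section MonomialIdeals

variable (K : Type*) [Field K] {ι : Type*} [DecidableEq ι]

/-- The projection `K[x_i : i ∈ ι] → K[x_i : i ∈ B]` killing the variables outside `B`. -/
noncomputable def projOnto (B : Finset ι) : MvPolynomial ι K →ₐ[K] MvPolynomial B K :=
  aeval fun i => if h : i ∈ B then X ⟨i, h⟩ else 0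

/-- The face ideal generated by the variables outside `B`. -/
noncomputable def faceIdeal (B : Finset ι) : Ideal (MvPolynomial ι K) :=
  RingHom.ker (projOnto K B)

variable {K}

lemma projOnto_X_of_mem {B : Finset ι} {i : ι} (h : i ∈ B) :
    projOnto K B (X i) = X ⟨i, h⟩ := by
  simp [projOnto, h]

lemma projOnto_X_of_notMem {B : Finset ι} {i : ι} (h : i ∉ B) :
    projOnto K B (X i) = 0 := by
  simp [projOnto, h]

lemma projOnto_surjective (B : Finset ι) : Function.Surjective (projOnto K B) := by
  have : (projOnto K B).comp (rename Subtype.val) = AlgHom.id K _ := by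
    ext i
    simp [projOnto]
  exact fun p => ⟨rename Subtype.val p, DFunLike.congr_fun this p⟩

instance faceIdeal_isPrime (B : Finset ι) : (faceIdeal K B).IsPrime :=
  RingHom.ker_isPrime _

lemma X_mem_faceIdeal {B : Finset ι} {i : ι} :
    (X i : MvPolynomial ι K) ∈ faceIdeal K B ↔ i ∉ B := by
  rw [faceIdeal, RingHom.mem_ker]
  by_cases h : i ∈ B
  · change projOnto K B (X i) = 0 ↔ _
    simp [projOnto_X_of_mem h, h, X_ne_zero]
  · change projOnto K B (X i) = 0 ↔ _
    simp [projOnto_X_of_notMem h, h]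

lemma faceIdeal_eq_span (B : Finset ι) :
    faceIdeal K B = Ideal.span (X '' {i | i ∉ B}) := by
  refine le_antisymm (fun f hf => ?_) ?_
  · set I : Ideal (MvPolynomial ι K) := Ideal.span (X '' {i | i ∉ B}) with hI
    have h : (Ideal.Quotient.mkₐ K I).comp ((rename Subtype.val).comp (projOnto K B)) =
        Ideal.Quotient.mkₐ K I := by
      refine MvPolynomial.algHom_ext fun i => ?_
      by_cases hi : i ∈ B
      · simp [projOnto_X_of_mem hi]
      · simp only [AlgHom.comp_apply, projOnto_X_of_notMem hi, map_zero]
        have hX : (X i : MvPolynomial ι K) ∈ I := Ideal.subset_span ⟨i, hi, rfl⟩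
        exact (Ideal.Quotient.eq_zero_iff_mem.2 hX).symm
    have h2 := DFunLike.congr_fun h f
    have hf0 : projOnto K B f = 0 := hf
    simp only [AlgHom.comp_apply, hf0, map_zero] at h2
    exact Ideal.Quotient.eq_zero_iff_mem.1 h2.symm
  · rw [Ideal.span_le]
    rintro _ ⟨i, hi, rfl⟩
    exact X_mem_faceIdeal.2 hi

lemma ringKrullDim_quotient_faceIdeal (B : Finset ι) :
    ringKrullDim (MvPolynomial ι K ⧸ faceIdeal K B) = (B.card : WithBot ℕ∞) := by
  rw [faceIdeal, ringKrullDim_eq_of_ringEquiv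
    (Ideal.quotientKerAlgEquivOfSurjective (projOnto_surjective (K := K) B)).toRingEquiv,
    MvPolynomial.ringKrullDim_of_isNoetherianRing,
      ringKrullDim_eq_zero_of_field, zero_add]
  simp

omit [DecidableEq ι] in
lemma prod_X_eq_monomial (τ : Finset ι) :
    (∏ i ∈ τ, X i : MvPolynomial ι K) = monomial (∑ i ∈ τ, Finsupp.single i 1) 1 := by
  rw [monomial_sum_one]
  rfl

omit [DecidableEq ι] in
lemma sum_single_le_iff {τ : Finset ι} {a : ι →₀ ℕ} :
    ∑ i ∈ τ, Finsupp.single i 1 ≤ a ↔ τ ⊆ a.support := by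
  classical
  constructor
  · intro h i hi
    have := h i
    rw [Finsupp.finsetSum_apply, Finset.sum_eq_single_of_mem i hi
      (fun j _ hj => by simp [hj])] at this
    simp only [Finsupp.single_eq_same] at this
    rw [Finsupp.mem_support_iff]
    omega
  · intro h i
    rw [Finsupp.finsetSum_apply]
    by_cases hi : i ∈ τ
    · rw [Finset.sum_eq_single_of_mem i hi (fun j _ hj => by simp [hj]), Finsupp.single_eq_same]
      exact Nat.one_le_iff_ne_zero.2 (Finsupp.mem_support_iff.1 (h hi))
    · rw [Finset.sum_eq_zero]
      · exact Nat.zero_le _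
      · intro j hj
        rw [Finsupp.single_apply, if_neg]
        rintro rfl
        exact hi hj

omit [DecidableEq ι] in
lemma monomial_mem_srIdeal {Δ : FaceSet ι} (hΔ : IsSimplicialComplex Δ) {a : ι →₀ ℕ} :
    monomial a (1 : K) ∈ srIdeal K Δ ↔ a.support ∉ Δ := by
  classical
  have h : srIdeal K Δ = Ideal.span ((fun s => monomial s (1 : K)) ''
      {s | ∃ τ : Finset ι, τ ∉ Δ ∧ s = ∑ i ∈ τ, Finsupp.single i 1}) := by
    rw [srIdeal]
    congr 1
    ext p
    constructor
    · rintro ⟨τ, h1, rfl⟩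
      exact ⟨_, ⟨τ, h1, rfl⟩, (prod_X_eq_monomial τ).symm⟩
    · rintro ⟨_, ⟨τ, h1, rfl⟩, rfl⟩
      exact ⟨τ, h1, (prod_X_eq_monomial τ).symm⟩
  rw [h, mem_ideal_span_monomial_image, support_monomial, if_neg one_ne_zero]
  simp only [Finset.mem_singleton, forall_eq, Set.mem_ofPred_eq]
  constructor
  · rintro ⟨_, ⟨τ, h1, rfl⟩, h2⟩ h3
    exact h1 (hΔ _ h3 _ (sum_single_le_iff.1 h2))
  · intro h
    exact ⟨_, ⟨_, h, rfl⟩, sum_single_le_iff.2 subset_rfl⟩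

lemma srIdeal_le_faceIdeal {Δ : FaceSet ι} (hΔ : IsSimplicialComplex Δ) {B : Finset ι}
    (hB : B ∈ Δ) : srIdeal K Δ ≤ faceIdeal K B := by
  rw [srIdeal, Ideal.span_le]
  rintro _ ⟨τ, hτ, rfl⟩
  obtain ⟨i, hi, hiB⟩ := Finset.not_subset.1 fun h => hτ (hΔ _ hB _ h)
  exact Ideal.mem_of_dvd _ (Finset.dvd_prod_of_mem _ hi) (X_mem_faceIdeal.2 hiB)

/-- Every prime containing a Stanley-Reisner ideal contains the face ideal of a facet. -/
lemma exists_faceIdeal_le [Fintype ι] {Δ : FaceSet ι} {p : Ideal (MvPolynomial ι K)}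
    (hp : p.IsPrime)
    (h : srIdeal K Δ ≤ p) : ∃ B ∈ facets Δ, faceIdeal K B ≤ p := by
  classical
  set S : Finset ι := Finset.univ.filter fun i => X i ∉ p with hS
  have hSΔ : S ∈ Δ := by
    by_contra hn
    have : (∏ i ∈ S, X i : MvPolynomial ι K) ∈ p := h (Ideal.subset_span ⟨S, hn, rfl⟩)
    obtain ⟨i, hi, hip⟩ := (hp.prod_mem_iff).1 this
    exact (Finset.mem_filter.1 hi).2 hip
  obtain ⟨B, hB, hSB⟩ := exists_facet hSΔ
  refine ⟨B, hB, ?_⟩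
  rw [faceIdeal_eq_span, Ideal.span_le]
  rintro _ ⟨i, hi, rfl⟩
  by_contra hip
  exact hi (hSB (Finset.mem_filter.2 ⟨Finset.mem_univ i, hip⟩))

lemma faceIdeal_le_iff {B B' : Finset ι} (h : faceIdeal K B ≤ faceIdeal K B') : B' ⊆ B := by
  intro i hi
  by_contra hiB
  exact X_mem_faceIdeal.1 (h (X_mem_faceIdeal.2 hiB)) hi

lemma mem_minimalPrimes_srIdeal [Fintype ι] {Δ : FaceSet ι} (hΔ : IsSimplicialComplex Δ)
    {p : Ideal (MvPolynomial ι K)} :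
    p ∈ (srIdeal K Δ).minimalPrimes ↔ ∃ B ∈ facets Δ, p = faceIdeal K B := by
  constructor
  · rintro ⟨⟨hp, hle⟩, hmin⟩
    obtain ⟨B, hB, hBp⟩ := exists_faceIdeal_le hp hle
    exact ⟨B, hB, le_antisymm
      (hmin ⟨faceIdeal_isPrime B, srIdeal_le_faceIdeal hΔ hB.1⟩ hBp) hBp⟩
  · rintro ⟨B, hB, rfl⟩
    refine ⟨⟨faceIdeal_isPrime B, srIdeal_le_faceIdeal hΔ hB.1⟩, fun q ⟨hq, hle⟩ hqB => ?_⟩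
    obtain ⟨B', hB', hBq⟩ := exists_faceIdeal_le hq hle
    rwa [hB.2 B' hB'.1 (faceIdeal_le_iff (hBq.trans hqB))]

omit [DecidableEq ι] in
/-- The Krull dimension of a Stanley-Reisner ring all of whose facets have `ρ` elements. -/
lemma ringKrullDim_quotient_srIdeal [Fintype ι] {Δ : FaceSet ι} (hΔ : IsSimplicialComplex Δ)
    {ρ : ℕ} (hρ : ∀ B ∈ facets Δ, B.card = ρ) (hne : (facets Δ).Nonempty) :
    ringKrullDim (MvPolynomial ι K ⧸ srIdeal K Δ) = (ρ : WithBot ℕ∞) := by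
  classical
  apply le_antisymm
  · rw [ringKrullDim_quotient]
    refine iSup_le fun l => ?_
    obtain ⟨B, hB, hle⟩ := exists_faceIdeal_le l.head.1.isPrime l.head.2
    have hl : ∀ i, (l i).1 ∈ PrimeSpectrum.zeroLocus (R := MvPolynomial ι K) (faceIdeal K B) :=
      fun i => hle.trans (l.strictMono.monotone (Fin.zero_le i))
    let l' : LTSeries (PrimeSpectrum.zeroLocus (R := MvPolynomial ι K) (faceIdeal K B)) :=
      LTSeries.mk l.length (fun i => ⟨(l i).1, hl i⟩) fun i j hij => l.strictMono hij
    rw [← hρ B hB, ← ringKrullDim_quotient_faceIdeal (K := K), ringKrullDim_quotient]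
    exact Order.LTSeries.length_le_krullDim l'
  · obtain ⟨B, hB⟩ := hne
    rw [← hρ B hB, ← ringKrullDim_quotient_faceIdeal (K := K)]
    exact ringKrullDim_le_of_surjective
      (Ideal.Quotient.factor (srIdeal_le_faceIdeal hΔ hB.1))
      (Ideal.Quotient.factor_surjective _)

/-- Monomials of a polynomial in the `n`-th power of a face ideal have degree at least `n` in the
variables outside the face. -/
lemma le_sum_of_mem_faceIdeal_pow [Fintype ι] (B : Finset ι) (n : ℕ) {f : MvPolynomial ι K}
    (hf : f ∈ faceIdeal K B ^ n) : ∀ a ∈ f.support, n ≤ ∑ i ∈ Bᶜ, a i := by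
  let J : ℕ → Ideal (MvPolynomial ι K) := fun n =>
    Ideal.span ((fun s => monomial s (1 : K)) '' {s | n ≤ ∑ i ∈ Bᶜ, s i})
  have hmem : ∀ n (f : MvPolynomial ι K), f ∈ J n ↔ ∀ a ∈ f.support, n ≤ ∑ i ∈ Bᶜ, a i := by
    intro n f
    rw [mem_ideal_span_monomial_image]
    constructor
    · intro h a ha
      obtain ⟨s, hs, hsa⟩ := h a ha
      exact le_trans hs (Finset.sum_le_sum fun i _ => hsa i)
    · exact fun h a ha => ⟨a, h a ha, le_rfl⟩
  rw [← hmem]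
  suffices h : faceIdeal K B ^ n ≤ J n from h hf
  clear hf
  induction n with
  | zero =>
    intro f _
    rw [hmem]
    exact fun a _ => Nat.zero_le _
  | succ n ih =>
    rw [pow_succ, Ideal.mul_le]
    intro p hp q hq
    rw [hmem]
    intro a ha
    obtain ⟨b, hb, c, hc, rfl⟩ := Finset.mem_add.1 (support_mul p q ha)
    have h1 := (hmem n p).1 (ih hp) b hb
    rw [faceIdeal_eq_span, mem_ideal_span_X_image] at hq
    obtain ⟨i, hi, hci⟩ := hq c hc
    have h2 : c i ≤ ∑ i ∈ Bᶜ, c i :=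
      Finset.single_le_sum (fun _ _ => Nat.zero_le _) (Finset.mem_compl.2 hi)
    simp only [Finsupp.add_apply, Finset.sum_add_distrib]
    omega

lemma exists_mem_support_of_notMem_faceIdeal {B : Finset ι} {s : MvPolynomial ι K}
    (hs : s ∉ faceIdeal K B) : ∃ b ∈ s.support, ∀ i ∉ B, b i = 0 := by
  rw [faceIdeal_eq_span, mem_ideal_span_X_image] at hs
  push Not at hs
  exact hs

omit [DecidableEq ι] in
lemma monomial_eq_prod_X [Fintype ι] (a : ι →₀ ℕ) :
    monomial a (1 : K) = ∏ i, X i ^ a i := by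
  rw [monomial_eq, C_1, one_mul, Finsupp.prod_fintype]
  simp

lemma exists_mul_monomial_mem_srIdeal_pow [Fintype ι] {Δ : FaceSet ι} {B : Finset ι}
    (hB : B ∈ facets Δ) {n : ℕ} {a : ι →₀ ℕ} (h : n ≤ ∑ i ∈ Bᶜ, a i) :
    ∃ s ∉ faceIdeal K B, s * monomial a (1 : K) ∈ srIdeal K Δ ^ n := by
  set p : MvPolynomial ι K := ∏ i ∈ B, X i with hp
  have hpB : p ∉ faceIdeal K B := by
    intro hmem
    obtain ⟨i, hi, hi'⟩ := ((faceIdeal_isPrime B).prod_mem_iff).1 hmem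
    exact X_mem_faceIdeal.1 hi' hi
  refine ⟨p ^ ∑ i ∈ Bᶜ, a i, fun hmem => hpB ((faceIdeal_isPrime B).mem_of_pow_mem _ hmem), ?_⟩
  have hmem : ∀ i ∈ Bᶜ, (p * X i) ^ a i ∈ srIdeal K Δ ^ a i := by
    intro i hi
    rw [Finset.mem_compl] at hi
    have : p * X i ∈ srIdeal K Δ := Ideal.subset_span
      ⟨insert i B, insert_notMem_of_facet hB hi, by rw [Finset.prod_insert hi, mul_comm]⟩
    exact Ideal.pow_mem_pow this _
  have hprod : ∏ i ∈ Bᶜ, (p * X i) ^ a i ∈ srIdeal K Δ ^ n := by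
    refine Ideal.pow_le_pow_right h ?_
    rw [← Finset.prod_pow_eq_pow_sum]
    exact Ideal.prod_mem_prod hmem
  have heq : p ^ (∑ i ∈ Bᶜ, a i) * monomial a (1 : K) =
      (∏ i ∈ B, X i ^ a i) * ∏ i ∈ Bᶜ, (p * X i) ^ a i := by
    rw [monomial_eq_prod_X, ← Finset.prod_mul_prod_compl B]
    simp only [mul_pow, Finset.prod_mul_distrib, Finset.prod_pow_eq_pow_sum]
    ring
  rw [heq]
  exact Ideal.mul_mem_left _ _ hprod

/-- The monomials in the symbolic powers of a Stanley-Reisner ideal. -/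
lemma monomial_mem_symbolicPower [Fintype ι] {Δ : FaceSet ι} (hΔ : IsSimplicialComplex Δ)
    {n : ℕ} {a : ι →₀ ℕ} :
    monomial a (1 : K) ∈ symbolicPower (srIdeal K Δ) n ↔
      ∀ B ∈ facets Δ, n ≤ ∑ i ∈ Bᶜ, a i := by
  have hloc : ∀ p : Ideal (MvPolynomial ι K), ∀ _ : p.IsPrime, ∀ f : MvPolynomial ι K,
      f ∈ (Ideal.map (algebraMap _ (Localization.AtPrime p)) (srIdeal K Δ ^ n)).comap
        (algebraMap _ (Localization.AtPrime p)) ↔ ∃ s ∉ p, s * f ∈ srIdeal K Δ ^ n := by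
    intro p hp f
    rw [Ideal.mem_comap, IsLocalization.algebraMap_mem_map_algebraMap_iff p.primeCompl]
    rfl
  simp only [symbolicPower, Ideal.mem_iInf]
  constructor
  · intro h B hB
    obtain ⟨s, hs, hmem⟩ := (hloc _ (faceIdeal_isPrime B) _).1
      (h (faceIdeal K B) ((mem_minimalPrimes_srIdeal hΔ).2 ⟨B, hB, rfl⟩))
    obtain ⟨b, hb, hb0⟩ := exists_mem_support_of_notMem_faceIdeal hs
    have := le_sum_of_mem_faceIdeal_pow B n
      (Ideal.pow_right_mono (srIdeal_le_faceIdeal hΔ hB.1) n hmem) (b + a) (by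
        rw [mem_support_iff, coeff_mul_monomial, mul_one]
        exact mem_support_iff.1 hb)
    refine this.trans (Finset.sum_le_sum fun i hi => ?_)
    rw [Finsupp.add_apply, hb0 i (Finset.mem_compl.1 hi), zero_add]
  · intro h p hp
    obtain ⟨B, hB, rfl⟩ := (mem_minimalPrimes_srIdeal hΔ).1 hp
    exact (hloc _ (faceIdeal_isPrime B) _).2 (exists_mul_monomial_mem_srIdeal_pow hB (h B hB))

end MonomialIdeals

section MinimalGenerators

variable {K : Type*} [Field K] {ι : Type*}

lemma support_sum_single (τ : Finset ι) :
    (∑ i ∈ τ, Finsupp.single i 1 : ι →₀ ℕ).support = τ := by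
  classical
  ext i
  rw [Finsupp.mem_support_iff, Finsupp.finsetSum_apply]
  simp [Finsupp.single_apply]

lemma sum_support_sum_single (τ : Finset ι) :
    ((∑ i ∈ τ, Finsupp.single i 1 : ι →₀ ℕ).sum fun _ k => k) = τ.card := by
  change (∑ i ∈ τ, Finsupp.single i 1 : ι →₀ ℕ).degree = _
  simp [map_sum]

lemma card_mem_minGenDegrees [Fintype ι] {Δ : FaceSet ι} (hΔ : IsSimplicialComplex Δ)
    {C : Finset ι} (hC : IsMinNonface Δ C) : C.card ∈ minGenDegrees K (srIdeal K Δ) := by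
  refine ⟨∑ i ∈ C, Finsupp.single i 1, ?_, fun b hb hne => ?_, (sum_support_sum_single C).symm⟩
  · rw [monomial_mem_srIdeal hΔ, support_sum_single]
    exact hC.1
  · rw [monomial_mem_srIdeal hΔ, not_not]
    have hsub : b.support ⊆ C := by
      have := Finsupp.support_mono hb
      rwa [support_sum_single] at this
    refine hC.2 _ (Finset.ssubset_iff_subset_ne.2 ⟨hsub, ?_⟩)
    intro he
    exact hne (le_antisymm hb (sum_single_le_iff.2 he.ge))

lemma exists_isMinNonface_of_mem_minGenDegrees [Fintype ι] {Δ : FaceSet ι}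
    (hΔ : IsSimplicialComplex Δ) {d : ℕ} (hd : d ∈ minGenDegrees K (srIdeal K Δ)) :
    ∃ C, IsMinNonface Δ C ∧ C.card = d := by
  obtain ⟨a, ha, hmin, rfl⟩ := hd
  rw [monomial_mem_srIdeal hΔ] at ha
  have key : ∀ D ⊆ a.support, D ∉ Δ → ∑ i ∈ D, Finsupp.single i 1 = a := by
    intro D hD hDΔ
    by_contra hne
    refine hmin _ (sum_single_le_iff.2 hD) hne ?_
    rwa [monomial_mem_srIdeal hΔ, support_sum_single]
  refine ⟨a.support, ⟨ha, fun D hD => ?_⟩, ?_⟩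
  · by_contra hDΔ
    have := congrArg Finsupp.support (key D hD.subset hDΔ)
    rw [support_sum_single] at this
    exact hD.ne this
  · conv_rhs => rw [← key _ subset_rfl ha]
    rw [sum_support_sum_single]

end MinimalGenerators

section DegreeComplex

variable {K : Type*} [Field K] {ι : Type*} [Fintype ι] [LinearOrder ι]

omit [LinearOrder ι] in
lemma mem_negSupport {α : ι → ℤ} {i : ι} : i ∈ negSupport α ↔ α i < 0 := by
  simp [negSupport]

omit [LinearOrder ι] in
lemma disjoint_negSupport_iff {α : ι → ℤ} {F : Finset ι} :
    Disjoint F (negSupport α) ↔ ∀ i ∈ F, 0 ≤ α i := by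
  rw [Finset.disjoint_left]
  simp only [mem_negSupport, not_lt]

/-- The exponent of the monomial `x^{α⁺} · (∏_{i ∈ S} x_i)^m`. -/
noncomputable def saturationExponent (α : ι → ℤ) (S : Finset ι) (m : ℕ) : ι →₀ ℕ :=
  Finsupp.equivFunOnFinite.symm fun i => (α i).toNat + if i ∈ S then m else 0

lemma monomial_saturationExponent (α : ι → ℤ) (S : Finset ι) (m : ℕ) :
    monomial (Finsupp.equivFunOnFinite.symm fun i => (α i).toNat) (1 : K) * (∏ i ∈ S, X i) ^ m =
      monomial (saturationExponent α S m) 1 := by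
  have h : (Finsupp.equivFunOnFinite.symm fun i => (α i).toNat) +
      m • ∑ i ∈ S, Finsupp.single i 1 = saturationExponent α S m := by
    ext i
    simp [saturationExponent, Finsupp.single_apply]
  rw [prod_X_eq_monomial, monomial_pow, monomial_mul, one_pow, mul_one, h]

lemma mem_degreeComplex {I : Ideal (MvPolynomial ι K)} {α : ι → ℤ} {F : Finset ι} :
    F ∈ degreeComplex K I α ↔ Disjoint F (negSupport α) ∧
      ∀ m, monomial (saturationExponent α (F ∪ negSupport α) m) (1 : K) ∉ I := by
  rw [disjoint_negSupport_iff, ← not_exists]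
  simp only [← monomial_saturationExponent]
  rfl

lemma reg_congr {I J : Ideal (MvPolynomial ι K)}
    (h : ∀ a, monomial a (1 : K) ∈ I ↔ monomial a (1 : K) ∈ J) : reg K I = reg K J := by
  have : ∀ α, degreeComplex K I α = degreeComplex K J α := fun α => by
    ext F
    simp only [mem_degreeComplex, h]
  simp only [reg, regQuot, lcNonzero, this]

lemma mem_degreeComplex_srIdeal {Γ : FaceSet ι} (hΓ : IsSimplicialComplex Γ) {α : ι → ℤ}
    {F : Finset ι} : F ∈ degreeComplex K (srIdeal K Γ) α ↔ Disjoint F (negSupport α) ∧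
      (Finset.univ.filter fun i => 0 < α i) ∪ (F ∪ negSupport α) ∈ Γ := by
  rw [mem_degreeComplex]
  refine and_congr_right fun _ => ?_
  simp only [monomial_mem_srIdeal hΓ, not_not]
  constructor
  · intro h
    refine hΓ _ (h 1) _ fun i hi => ?_
    rw [Finsupp.mem_support_iff]
    simp only [saturationExponent, Finsupp.equivFunOnFinite_symm_apply_apply]
    rcases Finset.mem_union.1 hi with hi | hi
    · have := (Finset.mem_filter.1 hi).2
      omega
    · rw [if_pos hi]
      omega
  · intro h m
    refine hΓ _ h _ fun i hi => ?_
    rw [Finsupp.mem_support_iff] at hi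
    simp only [saturationExponent, Finsupp.equivFunOnFinite_symm_apply_apply] at hi
    by_contra hn
    rw [Finset.mem_union, not_or, Finset.mem_filter] at hn
    rw [if_neg hn.2] at hi
    have : ¬ 0 < α i := fun h => hn.1 ⟨Finset.mem_univ i, h⟩
    omega

lemma lcNonzero_iff {I : Ideal (MvPolynomial ι K)} {i : ℕ} {α : ι → ℤ} :
    lcNonzero K I i α ↔
      ∃ d : ℕ, i = d + (negSupport α).card ∧ ¬ AcyclicAt K (degreeComplex K I α) d := by
  rw [lcNonzero, hasNontrivialReducedHomology_iff]
  refine exists_congr fun d => and_congr_left fun _ => ?_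
  omega

/-- The local cohomology of a Stanley-Reisner ring bounds its regularity by the size of faces. -/
lemma degree_le_of_lcNonzero_srIdeal {Γ : FaceSet ι} (hΓ : IsSimplicialComplex Γ) {ρ : ℕ}
    (hρ : ∀ F ∈ Γ, F.card ≤ ρ) {i : ℕ} {α : ι → ℤ} (h : lcNonzero K (srIdeal K Γ) i α) :
    ∑ j, α j + i ≤ ρ := by
  obtain ⟨d, rfl, hd⟩ := lcNonzero_iff.1 h
  have hα : ∀ j, α j ≤ 0 := by
    by_contra! hj
    obtain ⟨j, hj⟩ := hj
    refine hd (acyclicAt_of_cone (v := j) (fun F hF => ?_) d)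
    rw [mem_degreeComplex_srIdeal hΓ] at hF ⊢
    refine ⟨?_, hΓ _ hF.2 _ ?_⟩
    · rw [Finset.disjoint_insert_left]
      exact ⟨fun h => by rw [mem_negSupport] at h; omega, hF.1⟩
    · intro x hx
      simp only [Finset.mem_union, Finset.mem_insert, Finset.mem_filter, Finset.mem_univ,
        true_and] at hx ⊢
      rcases hx with h | (rfl | h) | h
      · exact Or.inl h
      · exact Or.inl hj
      · exact Or.inr (Or.inl h)
      · exact Or.inr (Or.inr h)
  obtain ⟨σ, hσ, hσd⟩ := exists_face_of_not_acyclicAt hd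
  rw [mem_degreeComplex_srIdeal hΓ] at hσ
  have h1 : d ≤ ρ := by
    rw [← hσd]
    refine (Finset.card_le_card ?_).trans (hρ _ hσ.2)
    exact Finset.subset_union_left.trans Finset.subset_union_right
  have h2 : ∑ j, α j ≤ ∑ j, if j ∈ negSupport α then (-1 : ℤ) else 0 := by
    refine Finset.sum_le_sum fun j _ => ?_
    split_ifs with hj
    · rw [mem_negSupport] at hj
      omega
    · exact hα j
  rw [Finset.sum_ite_mem, Finset.univ_inter, Finset.sum_const, nsmul_eq_mul] at h2
  push_cast
  omega

lemma reg_srIdeal_le {Γ : FaceSet ι} (hΓ : IsSimplicialComplex Γ) {ρ : ℕ}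
    (hρ : ∀ F ∈ Γ, F.card ≤ ρ) : reg K (srIdeal K Γ) ≤ ρ + 1 := by
  rw [reg, regQuot]
  refine add_le_add_left ?_ 1
  set S := {z : ℤ | ∃ (i : ℕ) (α : ι → ℤ), lcNonzero K (srIdeal K Γ) i α ∧ z = ∑ j, α j + i}
  rcases S.eq_empty_or_nonempty with h | h
  · rw [h, Int.csSup_empty]
    exact Int.natCast_nonneg ρ
  · refine csSup_le h ?_
    rintro _ ⟨i, α, hi, rfl⟩
    exact degree_le_of_lcNonzero_srIdeal hΓ hρ hi

lemma reg_symbolicPower_one {Δ : FaceSet ι} (hΔ : IsSimplicialComplex Δ) :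
    reg K (symbolicPower (srIdeal K Δ) 1) = reg K (srIdeal K Δ) := by
  refine reg_congr fun a => ?_
  rw [monomial_mem_symbolicPower hΔ, monomial_mem_srIdeal hΔ]
  constructor
  · intro h ha
    obtain ⟨B, hB, haB⟩ := exists_facet ha
    have := h B hB
    rw [Finset.sum_eq_zero] at this
    · omega
    · intro i hi
      by_contra hai
      exact Finset.mem_compl.1 hi (haB (Finsupp.mem_support_iff.2 hai))
  · intro h B hB
    obtain ⟨i, hi, hiB⟩ := Finset.not_subset.1 fun hs => h (hΔ B hB.1 _ hs)
    exact (Nat.one_le_iff_ne_zero.2 (Finsupp.mem_support_iff.1 hi)).trans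
      (Finset.single_le_sum (fun _ _ => Nat.zero_le _) (Finset.mem_compl.2 hiB))

lemma mem_degreeComplex_symbolicPower {Δ : FaceSet ι} (hΔ : IsSimplicialComplex Δ) {n : ℕ}
    {α : ι → ℤ} {F : Finset ι} :
    F ∈ degreeComplex K (symbolicPower (srIdeal K Δ) n) α ↔ Disjoint F (negSupport α) ∧
      ∃ B ∈ facets Δ, F ∪ negSupport α ⊆ B ∧ ∑ i ∈ Bᶜ, (α i).toNat < n := by
  rw [mem_degreeComplex]
  refine and_congr_right fun _ => ?_
  simp only [monomial_mem_symbolicPower hΔ, saturationExponent,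
    Finsupp.equivFunOnFinite_symm_apply_apply]
  push Not
  constructor
  · intro h
    obtain ⟨B, hB, hlt⟩ := h n
    refine ⟨B, hB, fun i hi => ?_, lt_of_le_of_lt (Finset.sum_le_sum fun i _ => ?_) hlt⟩
    · by_contra hiB
      refine absurd hlt (not_lt.2 ?_)
      refine le_trans ?_ (Finset.single_le_sum (fun _ _ => Nat.zero_le _)
        (Finset.mem_compl.2 hiB))
      rw [if_pos hi]
      omega
    · exact Nat.le_add_right _ _
  · rintro ⟨B, hB, hFB, hlt⟩ m
    refine ⟨B, hB, ?_⟩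
    rwa [Finset.sum_congr rfl fun i hi => by
      rw [if_neg fun h => Finset.mem_compl.1 hi (hFB h), add_zero]]

open Classical in
/-- The facets of the link of `G` in `Δ`. -/
noncomputable def linkFacets (Δ : FaceSet ι) (G : Finset ι) : Finset (Finset ι) :=
  Finset.univ.filter fun B => Disjoint B G ∧ B ∪ G ∈ facets Δ

lemma mem_linkFacets {Δ : FaceSet ι} {G B : Finset ι} :
    B ∈ linkFacets Δ G ↔ Disjoint B G ∧ B ∪ G ∈ facets Δ := by
  simp [linkFacets]

omit [Fintype ι] in
lemma insert_erase_union {B G : Finset ι} {x y : ι} (hx : x ∉ G) :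
    insert y ((B ∪ G).erase x) = insert y (B.erase x) ∪ G := by
  rw [Finset.erase_union_distrib, Finset.erase_eq_of_notMem hx, Finset.insert_union]

lemma IsMatroidComplex.symmExchange_linkFacets {Δ : FaceSet ι} (h : IsMatroidComplex Δ)
    (G : Finset ι) : SymmExchange (linkFacets Δ G) := by
  intro B hB B' hB' y hy
  rw [mem_linkFacets] at hB hB'
  obtain ⟨hyB', hyB⟩ := Finset.mem_sdiff.1 hy
  have hyG : y ∉ G := Finset.disjoint_left.1 hB'.1 hyB'
  obtain ⟨x, hx, h1, h2⟩ := h.exists_symm_exchange hB.2 hB'.2 (y := y) (by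
    simp [hyB', hyB, hyG])
  simp only [Finset.mem_sdiff, Finset.mem_union, not_or] at hx
  have hxG := hx.2.2
  have hxB := hx.1.resolve_right hxG
  rw [insert_erase_union hxG] at h1
  rw [insert_erase_union hyG] at h2
  refine ⟨x, Finset.mem_sdiff.2 ⟨hxB, hx.2.1⟩, mem_linkFacets.2 ⟨?_, h1⟩,
    mem_linkFacets.2 ⟨?_, h2⟩⟩
  · exact Finset.disjoint_insert_left.2 ⟨hyG, hB.1.mono_left (Finset.erase_subset _ _)⟩
  · exact Finset.disjoint_insert_left.2 ⟨hxG, hB'.1.mono_left (Finset.erase_subset _ _)⟩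

lemma degreeComplex_symbolicPower {Δ : FaceSet ι} (hΔ : IsSimplicialComplex Δ) (n : ℕ)
    (α : ι → ℤ) : degreeComplex K (symbolicPower (srIdeal K Δ) n) α =
      generated ((linkFacets Δ (negSupport α)).filter
        fun B => ∑ i ∈ (B ∪ negSupport α)ᶜ, (α i).toNat < n) := by
  ext F
  rw [mem_degreeComplex_symbolicPower hΔ]
  simp only [generated, Finset.mem_filter, mem_linkFacets, Set.mem_ofPred_eq]
  constructor
  · rintro ⟨hF, B, hB, hFB, hlt⟩
    have hG := Finset.union_subset_right hFB
    have hBG : B \ negSupport α ∪ negSupport α = B := Finset.sdiff_union_of_subset hG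
    refine ⟨B \ negSupport α, ⟨⟨Finset.sdiff_disjoint, by rwa [hBG]⟩, by rwa [hBG]⟩, ?_⟩
    exact Finset.subset_sdiff.2 ⟨Finset.union_subset_left hFB, hF⟩
  · rintro ⟨B, ⟨⟨hd, hB⟩, hlt⟩, hFB⟩
    exact ⟨hd.mono_left hFB, _, hB, Finset.union_subset_union_left hFB, hlt⟩

lemma sum_union_compl {B G : Finset ι} (h : Disjoint B G) (w : ι → ℕ) :
    ∑ i ∈ B, w i + ∑ i ∈ G, w i + ∑ i ∈ (B ∪ G)ᶜ, w i = ∑ i, w i := by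
  rw [← Finset.sum_union h, Finset.sum_add_sum_compl]

/-- Passing to larger generic weight preserves small weight of the complement. -/
lemma sum_compl_lt_of_generic {w w' : ι → ℕ} {G B B' : Finset ι} {n : ℕ}
    (hw : ∀ B B' : Finset ι, ∑ i ∈ B, w' i < ∑ i ∈ B', w' i → ∑ i ∈ B, w i ≤ ∑ i ∈ B', w i)
    (hB : Disjoint B G) (hB' : Disjoint B' G) (hlt : ∑ i ∈ (B ∪ G)ᶜ, w i < n)
    (h : ∑ i ∈ B, w' i < ∑ i ∈ B', w' i) : ∑ i ∈ (B' ∪ G)ᶜ, w i < n := by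
  have h1 := sum_union_compl hB w
  have h2 := sum_union_compl hB' w
  have h3 := hw _ _ h
  omega

omit [Fintype ι] in
/-- At most `c - 1` elements of a facet can be exchanged for a fixed outside element, where `c`
bounds the size of minimal nonfaces. -/
lemma card_exchangeable_lt {Δ : FaceSet ι} (hΔ : IsSimplicialComplex Δ) {c : ℕ}
    (hc : ∀ C, IsMinNonface Δ C → C.card ≤ c) {B S : Finset ι} (hB : B ∈ facets Δ) {u : ι}
    (hu : u ∉ B) (hSB : S ⊆ B) (hS : ∀ v ∈ S, insert u (B.erase v) ∈ Δ) : S.card + 1 ≤ c := by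
  obtain ⟨C, hCB, hC⟩ := exists_isMinNonface (insert_notMem_of_facet hB hu)
  rw [← Finset.card_insert_of_notMem fun h => hu (hSB h)]
  refine (Finset.card_le_card (Finset.insert_subset ?_ fun v hv => ?_)).trans (hc C hC)
  · by_contra huC
    exact hC.1 (hΔ B hB.1 C ((Finset.subset_insert_iff_of_notMem huC).1 hCB))
  · by_contra hvC
    refine hC.1 (hΔ _ (hS v hv) C fun x hx => ?_)
    have := hCB hx
    simp only [Finset.mem_insert, Finset.mem_erase] at this ⊢
    exact this.imp id fun h => ⟨by rintro rfl; exact hvC hx, h⟩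

/-- The degrees in the local cohomology of symbolic powers of matroid ideals. -/
lemma IsMatroidComplex.degree_le_of_lcNonzero {Δ : FaceSet ι} (h : IsMatroidComplex Δ) {ρ c : ℕ}
    (hρ : ∀ B ∈ facets Δ, B.card = ρ) (hc : ∀ C, IsMinNonface Δ C → C.card ≤ c) {n i : ℕ}
    {α : ι → ℤ} (hlc : lcNonzero K (symbolicPower (srIdeal K Δ) (n + 1)) i α) :
    ∑ j, α j + i ≤ c * n + ρ := by
  obtain ⟨d, rfl, hd⟩ := lcNonzero_iff.1 hlc
  rw [degreeComplex_symbolicPower h.1] at hd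
  set G := negSupport α with hG
  set w : ι → ℕ := fun i => (α i).toNat with hwdef
  obtain ⟨w', hw1, hw2⟩ := exists_generic_weight w
  obtain ⟨B, hB, rfl, hpass⟩ : ∃ B ∈ (linkFacets Δ G).filter
      (fun B => ∑ i ∈ (B ∪ G)ᶜ, w i < n + 1), d = B.card ∧
      ∀ v ∈ B, IsPassive (linkFacets Δ G) w' B v := by
    by_contra! hno
    refine hd ((h.symmExchange_linkFacets G).acyclicAt_generated hw2 _
      (Finset.filter_subset _ _) ?_ hno)
    intro B hB B' hB' hlt
    rw [Finset.mem_filter] at hB ⊢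
    exact ⟨hB', sum_compl_lt_of_generic hw1 (mem_linkFacets.1 hB.1).1 (mem_linkFacets.1 hB').1
      hB.2 hlt⟩
  obtain ⟨hBm, hBlt⟩ := Finset.mem_filter.1 hB
  obtain ⟨hBG, hBf⟩ := mem_linkFacets.1 hBm
  have hpass' : ∀ v, ∃ u, v ∈ B → u ∈ (B ∪ G)ᶜ ∧ insert u ((B ∪ G).erase v) ∈ Δ ∧ w v ≤ w u := by
    intro v
    by_cases hv : v ∈ B
    · obtain ⟨u, hu, hm, hl⟩ := hpass v hv
      obtain ⟨hdisj, hf⟩ := mem_linkFacets.1 hm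
      have huG : u ∉ G := (Finset.disjoint_insert_left.1 hdisj).1
      refine ⟨u, fun _ => ⟨by simp [hu, huG], ?_, ?_⟩⟩
      · rw [insert_erase_union (Finset.disjoint_left.1 hBG hv)]
        exact hf.1
      · simpa using hw1 {v} {u} (by simpa using hl)
    · exact ⟨v, fun h => absurd h hv⟩
  choose u hu using hpass'
  have hsumB : ∑ v ∈ B, w v ≤ ∑ t ∈ (B ∪ G)ᶜ, (B.filter fun v => u v = t).card * w t := by
    calc ∑ v ∈ B, w v ≤ ∑ v ∈ B, w (u v) := Finset.sum_le_sum fun v hv => (hu v hv).2.2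
      _ = ∑ t ∈ (B ∪ G)ᶜ, ∑ v ∈ B.filter fun v => u v = t, w (u v) :=
        (Finset.sum_fiberwise_of_maps_to (fun v hv => (hu v hv).1) _).symm
      _ = _ := Finset.sum_congr rfl fun t _ => by
        rw [Finset.sum_congr rfl (g := fun _ => w t), Finset.sum_const, smul_eq_mul]
        intro v hv
        rw [(Finset.mem_filter.1 hv).2]
  have hfib : ∑ t ∈ (B ∪ G)ᶜ, ((B.filter fun v => u v = t).card * w t + w t) ≤
      c * ∑ t ∈ (B ∪ G)ᶜ, w t := by
    rw [Finset.mul_sum]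
    refine Finset.sum_le_sum fun t ht => ?_
    rw [← Nat.succ_mul]
    refine Nat.mul_le_mul_right _ (card_exchangeable_lt h.1 hc hBf (Finset.mem_compl.1 ht)
      ((Finset.filter_subset _ _).trans Finset.subset_union_left) fun v hv => ?_)
    obtain ⟨hvB, rfl⟩ := Finset.mem_filter.1 hv
    exact (hu v hvB).2.1
  rw [Finset.sum_add_distrib] at hfib
  have hGw : ∑ i ∈ G, w i = 0 := Finset.sum_eq_zero fun i hi => by
    rw [hG, mem_negSupport] at hi
    simp only [hwdef]
    omega
  have htot := sum_union_compl hBG w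
  have hn : c * ∑ t ∈ (B ∪ G)ᶜ, w t ≤ c * n := Nat.mul_le_mul_left c (Nat.lt_succ_iff.1 hBlt)
  have hα : ∑ j, α j ≤ ((∑ j, w j : ℕ) : ℤ) := by
    push_cast
    exact Finset.sum_le_sum fun j _ => Int.self_le_toNat _
  have hcard : B.card + G.card = ρ := by
    rw [← hρ _ hBf, Finset.card_union_of_disjoint hBG]
  have : ∑ j, w j ≤ c * n := by omega
  zify at this hcard
  push_cast at hα ⊢
  linarith

/-- In a matroid complex that is not a cone, the extremal degree is attained. -/
lemma IsMatroidComplex.lcNonzero_of_isMinNonface {Δ : FaceSet ι} (h : IsMatroidComplex Δ) {ρ : ℕ}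
    (hρ : ∀ B ∈ facets Δ, B.card = ρ) (hne : (facets Δ).Nonempty)
    (hcone : ∀ v, ∃ B ∈ facets Δ, v ∉ B) {C : Finset ι} (hC : IsMinNonface Δ C) (n : ℕ) :
    lcNonzero K (symbolicPower (srIdeal K Δ) (n + 1)) ρ
      (fun i => if i ∈ C then (n : ℤ) else 0) := by
  set α : ι → ℤ := fun i => if i ∈ C then (n : ℤ) else 0 with hα
  have hG : negSupport α = ∅ := by
    ext i
    simp only [mem_negSupport, hα, Finset.notMem_empty, iff_false, not_lt]
    split_ifs <;> omega
  set w : ι → ℕ := fun i => (α i).toNat with hwdef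
  have hwC : ∀ i ∈ C, w i = n := fun i hi => by simp [hwdef, hα, hi]
  have hwC' : ∀ i ∉ C, w i = 0 := fun i hi => by simp [hwdef, hα, hi]
  refine lcNonzero_iff.2 ⟨ρ, by rw [hG]; simp, ?_⟩
  rw [degreeComplex_symbolicPower h.1, hG]
  obtain ⟨w', hw1, hw2⟩ := exists_generic_weight w
  have hmem : ∀ B, B ∈ (linkFacets Δ ∅).filter (fun B => ∑ i ∈ (B ∪ ∅)ᶜ, w i < n + 1) ↔
      B ∈ facets Δ ∧ ∑ i ∈ Bᶜ, w i < n + 1 := fun B => by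
    simp [Finset.mem_filter, mem_linkFacets]
  refine (h.symmExchange_linkFacets ∅).not_acyclicAt_generated hw2 _ (Finset.filter_subset _ _)
    ?_ (fun B hB => hρ B ((hmem B).1 hB).1) ?_ ?_
  · obtain ⟨c, hc⟩ : C.Nonempty := by
      rw [Finset.nonempty_iff_ne_empty]
      rintro rfl
      obtain ⟨B, hB⟩ := hne
      exact hC.1 (h.1 B hB.1 _ (Finset.empty_subset B))
    obtain ⟨B, hB, hCB⟩ := exists_facet (hC.2 _ (Finset.erase_ssubset hc))
    refine ⟨B, (hmem B).2 ⟨hB, Nat.lt_succ_iff.2 ?_⟩⟩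
    calc ∑ i ∈ Bᶜ, w i ≤ ∑ i ∈ Bᶜ, if i = c then n else 0 := by
          refine Finset.sum_le_sum fun i hi => ?_
          split_ifs with hic
          · rw [hic, hwC c hc]
          · refine (hwC' i fun hiC => ?_).le
            exact Finset.mem_compl.1 hi (hCB (Finset.mem_erase.2 ⟨hic, hiC⟩))
      _ ≤ n := by
          rw [Finset.sum_ite_eq']
          split_ifs <;> omega
  · intro B hB B' hB' hlt
    rw [Finset.mem_filter] at hB ⊢
    exact ⟨hB', sum_compl_lt_of_generic hw1 (mem_linkFacets.1 hB.1).1 (mem_linkFacets.1 hB').1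
      hB.2 hlt⟩
  · intro B hB v hv
    obtain ⟨hBf, hBlt⟩ := (hmem B).1 hB
    suffices hs : ∃ u ∉ B, insert u (B.erase v) ∈ facets Δ ∧ w v ≤ w u by
      obtain ⟨u, hu, hm, hl⟩ := hs
      refine ⟨u, hu, (hmem _).2 ⟨hm, ?_⟩⟩
      have h1 := Finset.sum_add_sum_compl B w
      have h2 := Finset.sum_add_sum_compl (insert u (B.erase v)) w
      rw [Finset.sum_insert fun h => hu (Finset.mem_of_mem_erase h)] at h2
      have h3 := Finset.sum_erase_add B w hv
      omega
    by_cases hvC : v ∈ C ∧ n ≠ 0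
    · obtain ⟨hvC, hn⟩ := hvC
      obtain ⟨u, huC, huB⟩ := Finset.not_subset.1 fun hs => hC.1 (h.1 B hBf.1 C hs)
      have hCsub : C ⊆ insert u B := by
        intro x hxC
        by_contra hx
        rw [Finset.mem_insert, not_or] at hx
        have hsub : {u, x} ⊆ Bᶜ := by
          simp [Finset.insert_subset_iff, huB, hx.2]
        have := Finset.sum_le_sum_of_subset (f := w) hsub
        rw [Finset.sum_pair (Ne.symm hx.1), hwC u huC, hwC x hxC] at this
        omega
      exact ⟨u, huB, h.exchange_mem_facets hBf huB hC hCsub hv hvC, by rw [hwC v hvC, hwC u huC]⟩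
    · have hwv : w v = 0 := by
        by_cases hv' : v ∈ C
        · rw [hwC v hv']
          tauto
        · exact hwC' v hv'
      obtain ⟨B', hB', hvB'⟩ := hcone v
      obtain ⟨u, hu, -, hm⟩ := h.exists_symm_exchange hB' hBf (Finset.mem_sdiff.2 ⟨hv, hvB'⟩)
      exact ⟨u, (Finset.mem_sdiff.1 hu).2, hm, by rw [hwv]; exact Nat.zero_le _⟩

end DegreeComplex

section Regularity

variable {K : Type*} [Field K] {ι : Type*} [Fintype ι] [LinearOrder ι]

/-- The regularity of the symbolic powers of the Stanley-Reisner ideal of a matroid. -/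
lemma IsMatroidComplex.reg_symbolicPower {Δ : FaceSet ι} (h : IsMatroidComplex Δ) {ρ c : ℕ}
    (hρ : ∀ B ∈ facets Δ, B.card = ρ) (hne : (facets Δ).Nonempty)
    (hcone : ∀ v, ∃ B ∈ facets Δ, v ∉ B) {C : Finset ι} (hC : IsMinNonface Δ C)
    (hCc : C.card = c) (hc : ∀ C, IsMinNonface Δ C → C.card ≤ c) (n : ℕ) :
    reg K (symbolicPower (srIdeal K Δ) (n + 1)) = c * n + ρ + 1 := by
  rw [reg, regQuot]
  congr 1
  refine IsGreatest.csSup_eq ⟨⟨ρ, _, h.lcNonzero_of_isMinNonface hρ hne hcone hC n, ?_⟩, ?_⟩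
  · rw [Finset.sum_ite_mem, Finset.univ_inter, Finset.sum_const, nsmul_eq_mul, hCc]
  · rintro _ ⟨i, α, hi, rfl⟩
    exact_mod_cast h.degree_le_of_lcNonzero hρ hc hi

end Regularity

/-- Let `Δ` be a matroid complex on `{1, …, r}` that is not a cone.
Then for all `n ≥ 1`, `reg(I_Δ^{(n)}) = δ(I_Δ)·(n − 1) + b`, where
`b = max{reg(I_Γ) : Γ subcomplex of Δ with F(Γ) ⊆ F(Δ)}`; moreover
`b = dim(R/I_Δ) + 1` and `δ(I_Δ) = d(I_Δ)`. -/
theorem statement13 {K : Type*} [Field K] {r : ℕ}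
    (Δ : FaceSet (Fin r)) (hmat : IsMatroidComplex Δ)
    (hcone : ¬∃ v : Fin r, IsConeOver Δ v)
    (δ : ℝ)
    (hδ : Filter.Tendsto (fun n : ℕ => (reg K (symbolicPower (srIdeal K Δ) n) : ℝ) / n)
      Filter.atTop (nhds δ))
    (b : ℤ)
    (hb : IsGreatest {z : ℤ | ∃ Γ : FaceSet (Fin r), IsSimplicialComplex Γ ∧ Γ ⊆ Δ ∧
        facets Γ ⊆ facets Δ ∧ z = reg K (srIdeal K Γ)} b)
    (d : ℕ)
    (hdim : ringKrullDim (MvPolynomial (Fin r) K ⧸ srIdeal K Δ) = (d : WithBot ℕ∞))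
    (dI : ℕ) (hdI : IsGreatest (minGenDegrees K (srIdeal K Δ)) dI) :
    (∀ n : ℕ, 1 ≤ n →
      (reg K (symbolicPower (srIdeal K Δ) n) : ℝ) = δ * (n - 1) + b) ∧
    b = (d : ℤ) + 1 ∧ δ = (dI : ℝ) := by
  have hne : Δ.Nonempty := by
    rw [Set.nonempty_iff_ne_empty]
    rintro rfl
    have htop : srIdeal K (∅ : FaceSet (Fin r)) = ⊤ :=
      (Ideal.eq_top_iff_one _).2 (Ideal.subset_span ⟨∅, Set.notMem_empty _, by simp⟩)
    rw [htop, ringKrullDim_eq_bot_of_subsingleton] at hdim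
    exact absurd hdim (by simp)
  obtain ⟨F₀, hF₀⟩ := hne
  obtain ⟨B₀, hB₀, -⟩ := exists_facet hF₀
  have hcard : ∀ B ∈ facets Δ, B.card = B₀.card := fun B hB => hmat.card_eq hB hB₀
  have hface : ∀ F ∈ Δ, F.card ≤ B₀.card := fun F hF => by
    obtain ⟨B, hB, hFB⟩ := exists_facet hF
    exact (Finset.card_le_card hFB).trans (hcard B hB).le
  have hd : d = B₀.card := by
    rw [ringKrullDim_quotient_srIdeal hmat.1 hcard ⟨B₀, hB₀⟩] at hdim
    exact_mod_cast hdim.symm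
  have havoid : ∀ v, ∃ B ∈ facets Δ, v ∉ B := fun v => by
    by_contra! hv
    refine hcone ⟨v, fun F hF => ?_⟩
    obtain ⟨B, hB, hFB⟩ := exists_facet hF
    exact hmat.1 B hB.1 _ (Finset.insert_subset (hv B hB) hFB)
  obtain ⟨C, hC, hCd⟩ := exists_isMinNonface_of_mem_minGenDegrees hmat.1 hdI.1
  have hreg : ∀ n, reg K (symbolicPower (srIdeal K Δ) (n + 1)) = dI * n + d + 1 := fun n => by
    rw [hd]
    exact hmat.reg_symbolicPower hcard ⟨B₀, hB₀⟩ havoid hC hCd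
      (fun D hD => hdI.2 (card_mem_minGenDegrees hmat.1 hD)) n
  have hbd : b = d + 1 := by
    refine le_antisymm ?_ ?_
    · obtain ⟨Γ, hΓ, hΓΔ, -, rfl⟩ := hb.1
      rw [hd]
      exact reg_srIdeal_le hΓ fun F hF => hface F (hΓΔ hF)
    · have h0 := hreg 0
      rw [zero_add, reg_symbolicPower_one hmat.1] at h0
      have := hb.2 ⟨Δ, hmat.1, subset_rfl, subset_rfl, rfl⟩
      rw [h0] at this
      simpa using this
  have hreg' : ∀ n : ℕ, 1 ≤ n →
      (reg K (symbolicPower (srIdeal K Δ) n) : ℝ) = dI * (n - 1) + b := fun n hn => by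
    obtain ⟨m, rfl⟩ := Nat.exists_eq_add_of_le' hn
    rw [hreg, hbd]
    push_cast
    ring
  have hδI : δ = dI := by
    refine tendsto_nhds_unique hδ ?_
    have hlim : Tendsto (fun n : ℕ => (dI : ℝ) + (b - dI) / n) atTop (nhds (dI + 0)) :=
      tendsto_const_nhds.add (tendsto_const_div_atTop_nhds_zero_nat _)
    rw [add_zero] at hlim
    refine hlim.congr' ?_
    filter_upwards [eventually_ge_atTop 1] with n hn
    have hn' : (n : ℝ) ≠ 0 := by positivity
    rw [hreg' n hn]
    field_simp
    ring
  exact ⟨hδI ▸ hreg', hbd, hδI⟩
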